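/- arXiv:2203.05005 — 2 statements merged into one kernel-verified Lean document; each statement's English description precedes it below -/
import Mathlib

section
/- Let X and Y be Polish path spaces with N time steps such that diam(X × Y) := sup over (x, y), (x̃, ỹ) ∈ X × Y of d_X(x, x̃) + d_Y(y, ỹ) is finite, and let p ∈ [1, ∞). Then any μ ∈ P(X) and ν ∈ P(Y) satisfy: for all π, π̃ ∈ Π(μ, ν), max{W_{p,c}(π, π̃), W_{p,ac}(π, π̃)} ≤ C_p · D_KL(π, π̃)^{1/(2p)}, with constant C_p = diam(X × Y) · 2^{N/p} · 2^{−1/(2p)}. -/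
open MeasureTheory ProbabilityTheory Filter Set
open scoped ENNReal NNReal Topology ProbabilityTheory

noncomputable section

namespace AOT

variable {N : ℕ}

/-- The σ-algebra on a path space generated by the `t`-th coordinate. -/
def coordσ (X : Fin N → Type*) [∀ t, MeasurableSpace (X t)] (t : Fin N) :
    MeasurableSpace (∀ s, X s) :=
  MeasurableSpace.comap (fun x => x t) inferInstance

/-- The σ-algebra generated by the coordinates (strictly) before time `t`, from a family
of coordinate σ-algebras. -/
def pastσOf {A : Type*} (m : Fin N → MeasurableSpace A) (t : ℕ) : MeasurableSpace A :=
  ⨆ s : Fin N, ⨆ _ : (s : ℕ) < t, m s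

/-- The σ-algebra on a path space generated by the coordinates before time `t`. -/
def pastσ (X : Fin N → Type*) [∀ t, MeasurableSpace (X t)] (t : ℕ) :
    MeasurableSpace (∀ s, X s) :=
  pastσOf (coordσ X) t

/-- Conditional independence of the sub-σ-algebras `m₁` and `m₂` given `m₃`, under the
measure `π`: for all sets `A ∈ m₁`, `B ∈ m₂`, the conditional expectation (given `m₃`)
of the indicator of `A ∩ B` is a.s. the product of those of `A` and of `B`. -/
def CondIndepσ {Ω : Type*} {mΩ : MeasurableSpace Ω} (m₁ m₂ m₃ : MeasurableSpace Ω)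
    (π : @Measure Ω mΩ) : Prop :=
  ∀ A B : Set Ω, MeasurableSet[m₁] A → MeasurableSet[m₂] B →
    (π[(A ∩ B).indicator (fun _ => (1 : ℝ)) | m₃]) =ᵐ[π]
      (π[A.indicator (fun _ => (1 : ℝ)) | m₃]) * (π[B.indicator (fun _ => (1 : ℝ)) | m₃])

/-- Causality of a measure on `A × B` relative to families of coordinate σ-algebras
`mA` on `A` and `mB` on `B`: for every time `t`, the `t`-th coordinate of the first
component is conditionally independent of the (strict) past of the second component,
given the (strict) past of the first component. -/
def IsCausalFor {A B : Type*} [MeasurableSpace A] [MeasurableSpace B]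
    (mA : Fin N → MeasurableSpace A) (mB : Fin N → MeasurableSpace B)
    (π : Measure (A × B)) : Prop :=
  ∀ t : Fin N,
    CondIndepσ ((mA t).comap Prod.fst)
      ((pastσOf mB (t : ℕ)).comap Prod.snd)
      ((pastσOf mA (t : ℕ)).comap Prod.fst) π

/-- Anticausality: causality with the roles of the two components exchanged. -/
def IsAnticausalFor {A B : Type*} [MeasurableSpace A] [MeasurableSpace B]
    (mA : Fin N → MeasurableSpace A) (mB : Fin N → MeasurableSpace B)
    (π : Measure (A × B)) : Prop :=
  IsCausalFor mB mA (π.map Prod.swap)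

/-- A coupling of a measure on `X₁ × ⋯ × X_N` and a measure on `Y₁ × ⋯ × Y_N` is causal if
under it, for every `t`, `Y_{1:t}` is conditionally independent of `X_{t+1}` given `X_{1:t}`. -/
def IsCausal {X Y : Fin N → Type*} [∀ t, MeasurableSpace (X t)] [∀ t, MeasurableSpace (Y t)]
    (π : Measure ((∀ t, X t) × (∀ t, Y t))) : Prop :=
  IsCausalFor (coordσ X) (coordσ Y) π

def IsAnticausal {X Y : Fin N → Type*} [∀ t, MeasurableSpace (X t)] [∀ t, MeasurableSpace (Y t)]
    (π : Measure ((∀ t, X t) × (∀ t, Y t))) : Prop :=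
  IsAnticausalFor (coordσ X) (coordσ Y) π

def IsBicausal {X Y : Fin N → Type*} [∀ t, MeasurableSpace (X t)] [∀ t, MeasurableSpace (Y t)]
    (π : Measure ((∀ t, X t) × (∀ t, Y t))) : Prop :=
  IsCausal π ∧ IsAnticausal π

/-- `π` is a coupling of `μ` and `ν`. -/
def IsCoupling {A B : Type*} [MeasurableSpace A] [MeasurableSpace B]
    (μ : Measure A) (ν : Measure B) (π : Measure (A × B)) : Prop :=
  π.map Prod.fst = μ ∧ π.map Prod.snd = ν

/-- The four flavors of (adapted) optimal transport: plain, causal, anticausal, bicausal. -/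
inductive Flavor | plain | causal | anticausal | bicausal

/-- The adaptedness constraint corresponding to a flavor. -/
def IsAdapted {X Y : Fin N → Type*} [∀ t, MeasurableSpace (X t)] [∀ t, MeasurableSpace (Y t)] :
    Flavor → Measure ((∀ t, X t) × (∀ t, Y t)) → Prop
  | .plain => fun _ => True
  | .causal => fun π => IsCausal π
  | .anticausal => fun π => IsAnticausal π
  | .bicausal => fun π => IsBicausal π

/-- The set `Π_•(μ, ν)` of couplings of `μ` and `ν` with the adaptedness constraint
given by the flavor `b`. -/
def aCouplings {X Y : Fin N → Type*} [∀ t, MeasurableSpace (X t)] [∀ t, MeasurableSpace (Y t)]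
    (b : Flavor) (μ : Measure (∀ t, X t)) (ν : Measure (∀ t, Y t)) :
    Set (Measure ((∀ t, X t) × (∀ t, Y t))) :=
  {π | IsCoupling μ ν π ∧ IsAdapted b π}

/-- `p`-th power transport cost of a coupling. -/
def lcost (p : ℝ) {A : Type*} [MeasurableSpace A] [PseudoEMetricSpace A]
    (π : Measure (A × A)) : ℝ≥0∞ :=
  ∫⁻ z, edist z.1 z.2 ^ p ∂π

/-- The (adapted) Wasserstein distance `W_{p,•}` between two measures on a path space. -/
def W {X : Fin N → Type*} [∀ t, MeasurableSpace (X t)] [∀ t, PseudoEMetricSpace (X t)]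
    (p : ℝ) (b : Flavor) (μ ν : Measure (∀ t, X t)) : ℝ≥0∞ :=
  (⨅ π : aCouplings b μ ν, lcost p π.1) ^ (1 / p)

/-- Coordinate σ-algebras on `X × Y` viewed as a single path space with
coordinates `X_t × Y_t`. -/
def coordσ2 (X Y : Fin N → Type*) [∀ t, MeasurableSpace (X t)] [∀ t, MeasurableSpace (Y t)]
    (t : Fin N) : MeasurableSpace ((∀ s, X s) × (∀ s, Y s)) :=
  ((coordσ X t).comap Prod.fst) ⊔ ((coordσ Y t).comap Prod.snd)

/-- Adaptedness for measures on `(X × Y) × (X × Y)`, where `X × Y` is regarded as a single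
path space with `N` time steps, the `t`-th coordinate being `X_t × Y_t`. -/
def IsAdapted2 {X Y : Fin N → Type*} [∀ t, MeasurableSpace (X t)] [∀ t, MeasurableSpace (Y t)] :
    Flavor → Measure (((∀ t, X t) × (∀ t, Y t)) × ((∀ t, X t) × (∀ t, Y t))) → Prop
  | .plain => fun _ => True
  | .causal => fun θ => IsCausalFor (coordσ2 X Y) (coordσ2 X Y) θ
  | .anticausal => fun θ => IsAnticausalFor (coordσ2 X Y) (coordσ2 X Y) θ
  | .bicausal => fun θ => IsCausalFor (coordσ2 X Y) (coordσ2 X Y) θ ∧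
      IsAnticausalFor (coordσ2 X Y) (coordσ2 X Y) θ

/-- The set `Π_•(π, π̃)` of couplings of two measures on `X × Y`, with adaptedness understood
for `X × Y` as one path space. -/
def aCouplings2 {X Y : Fin N → Type*} [∀ t, MeasurableSpace (X t)] [∀ t, MeasurableSpace (Y t)]
    (b : Flavor) (π ρ : Measure ((∀ t, X t) × (∀ t, Y t))) :
    Set (Measure (((∀ t, X t) × (∀ t, Y t)) × ((∀ t, X t) × (∀ t, Y t)))) :=
  {θ | IsCoupling π ρ θ ∧ IsAdapted2 b θ}

/-- `p`-th power transport cost `∫ d_X(x,x̃)^p + d_Y(y,ỹ)^p dθ` for couplings of couplings. -/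
def lcost2 (p : ℝ) {A B : Type*} [MeasurableSpace A] [MeasurableSpace B]
    [PseudoEMetricSpace A] [PseudoEMetricSpace B]
    (θ : Measure ((A × B) × (A × B))) : ℝ≥0∞ :=
  ∫⁻ z, (edist z.1.1 z.2.1 ^ p + edist z.1.2 z.2.2 ^ p) ∂θ

/-- The (adapted) Wasserstein distance `W_{p,•}(π, π̃)` between couplings, with cost
`d_X^p + d_Y^p` and `X × Y` regarded as one path space. -/
def W2 {X Y : Fin N → Type*} [∀ t, MeasurableSpace (X t)] [∀ t, MeasurableSpace (Y t)]
    [∀ t, PseudoEMetricSpace (X t)] [∀ t, PseudoEMetricSpace (Y t)]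
    (p : ℝ) (b : Flavor) (π ρ : Measure ((∀ t, X t) × (∀ t, Y t))) : ℝ≥0∞ :=
  (⨅ θ : aCouplings2 b π ρ, lcost2 p θ.1) ^ (1 / p)

/- Relative entropy (Kullback-Leibler divergence): `D_KL(π, ρ) = ∫ log (dπ/dρ) dπ` if
`π ≪ ρ` and the integral is defined, and `∞` otherwise. -/
open Classical in
def KL {Ω : Type*} [MeasurableSpace Ω] (π ρ : Measure Ω) : ℝ≥0∞ :=
  if π ≪ ρ ∧ Integrable (llr π ρ) π then ENNReal.ofReal (∫ ω, llr π ρ ω ∂π) else ⊤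

/-- The transport value `V_•(μ, ν, c)`. -/
def V {X Y : Fin N → Type*} [∀ t, MeasurableSpace (X t)] [∀ t, MeasurableSpace (Y t)]
    (b : Flavor) (μ : Measure (∀ t, X t)) (ν : Measure (∀ t, Y t))
    (c : (∀ t, X t) × (∀ t, Y t) → ℝ) : ℝ :=
  ⨅ π : aCouplings b μ ν, ∫ z, c z ∂π.1

/-- The entropic objective `∫ c dπ + ε D_KL(π, P)`, valued in `EReal`. -/
def entObj {Ω : Type*} [MeasurableSpace Ω] (c : Ω → ℝ) (ε : ℝ) (P : Measure Ω)
    (π : Measure Ω) : EReal :=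
  ((∫ z, c z ∂π : ℝ) : EReal) + (ε : EReal) * ((KL π P : ℝ≥0∞) : EReal)

/-- The entropic transport value `E_•^ε(μ, ν, c)`, valued in `EReal`. -/
def EE {X Y : Fin N → Type*} [∀ t, MeasurableSpace (X t)] [∀ t, MeasurableSpace (Y t)]
    (b : Flavor) (μ : Measure (∀ t, X t)) (ν : Measure (∀ t, Y t))
    (c : (∀ t, X t) × (∀ t, Y t) → ℝ) (ε : ℝ) : EReal :=
  ⨅ π : aCouplings b μ ν, entObj c ε (μ.prod ν) π.1

/-- The kernel `K(x, y) := K^μ(x) ⊗ K^ν(y)` used to build the shadow. -/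
def shadowKernel {A A' B B' : Type*} [MeasurableSpace A] [MeasurableSpace A']
    [MeasurableSpace B] [MeasurableSpace B']
    (Kμ : Kernel A A') (Kν : Kernel B B') : Kernel (A × B) (A' × B') :=
  (Kμ.comap Prod.fst measurable_fst) ×ₖ (Kν.comap Prod.snd measurable_snd)

/-- The `(K^μ, K^ν)`-shadow of `π`: the second marginal of `π ⊗ (K^μ ⊗ K^ν)`. -/
def shadow {A A' B B' : Type*} [MeasurableSpace A] [MeasurableSpace A']
    [MeasurableSpace B] [MeasurableSpace B']
    (π : Measure (A × B)) (Kμ : Kernel A A') (Kν : Kernel B B') : Measure (A' × B') :=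
  (π ⊗ₘ (shadowKernel Kμ Kν)).map Prod.snd

/-- `μ` has a finite `p`-th moment. -/
def MemPp {A : Type*} [MeasurableSpace A] [PseudoEMetricSpace A] (p : ℝ) (μ : Measure A) :
    Prop :=
  ∀ x₀ : A, ∫⁻ x, edist x₀ x ^ p ∂μ ≠ ⊤

/-- `c` has growth of order at most `p`. -/
def GrowthLE {A B : Type*} [PseudoEMetricSpace A] [PseudoEMetricSpace B]
    (p : ℝ) (c : A × B → ℝ) : Prop :=
  ∃ (x₀ : A) (y₀ : B) (M : ℝ), ∀ z : A × B,
    |c z| ≤ M * (1 + (edist x₀ z.1).toReal ^ p + (edist y₀ z.2).toReal ^ p)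

/-- Weak convergence of a sequence of measures (testing against bounded continuous
functions). -/
def WeakTendsto {A : Type*} [MeasurableSpace A] [TopologicalSpace A]
    (πs : ℕ → Measure A) (π : Measure A) : Prop :=
  ∀ f : BoundedContinuousFunction A ℝ,
    Tendsto (fun n => ∫ x, f x ∂(πs n)) atTop (𝓝 (∫ x, f x ∂π))

/-- A finitely supported (discrete) measure. -/
def FinitelySupported {A : Type*} [MeasurableSpace A] (μ : Measure A) : Prop :=
  ∃ s : Finset A, μ (↑s)ᶜ = 0


/-- `K` is a version of the conditional distribution of the random element `V` given the
sub-σ-algebra `m`, under the measure `ρ`. -/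
def IsCondDistrib' {Ω E : Type*} {mΩ : MeasurableSpace Ω} [MeasurableSpace E]
    (ρ : @Measure Ω mΩ) (V : Ω → E) (m : MeasurableSpace Ω) (K : Ω → Measure E) : Prop :=
  (∀ ω, IsProbabilityMeasure (K ω)) ∧
  (∀ A : Set E, MeasurableSet A → Measurable[m] (fun ω => (K ω A).toReal)) ∧
  (∀ A : Set E, MeasurableSet A →
    (ρ[(V ⁻¹' A).indicator (fun _ => (1 : ℝ)) | m]) =ᵐ[ρ] fun ω => (K ω A).toReal)

/-- `Kμ` is a family of disintegration kernels of `μ` on a path space: `Kμ t` is a version of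
the conditional distribution of the `t`-th coordinate given the past before `t`. -/
def IsDisintegration {X : Fin N → Type*} [∀ t, MeasurableSpace (X t)]
    (μ : Measure (∀ t, X t)) (Kμ : ∀ t : Fin N, (∀ s, X s) → Measure (X t)) : Prop :=
  ∀ t : Fin N, IsCondDistrib' μ (fun x => x t) (pastσ X (t : ℕ)) (Kμ t)

variable {X Y : Fin N → Type*} [∀ t, MeasurableSpace (X t)] [∀ t, MeasurableSpace (Y t)]

open Classical in
/-- Membership in the dual building block `A_{X,μ,t}` (relative to a fixed family `Kμ` of
disintegration kernels of `μ`): for `t = 1` the bounded measurable functions of `x₁`; for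
`t ≥ 2` functions `a_t(x_{1:t}, y_{1:t-1}) - ∫ a_t(x_{1:t-1}, x̃_t, y_{1:t-1}) μ_t^{x_{1:t-1}}(dx̃_t)`
with `a_t` bounded measurable. (Here `τ` is the 0-based coordinate index, `τ = t - 1`.) -/
def MemAX (Kμ : ∀ t : Fin N, (∀ s, X s) → Measure (X t)) (τ : Fin N)
    (f : (∀ t, X t) × (∀ t, Y t) → ℝ) : Prop :=
  if (τ : ℕ) = 0 then
    ∃ a : (∀ t, X t) × (∀ t, Y t) → ℝ,
      Measurable[(coordσ X τ).comap Prod.fst] a ∧ (∃ M, ∀ ω, |a ω| ≤ M) ∧ f = a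
  else
    ∃ a : (∀ t, X t) × (∀ t, Y t) → ℝ,
      Measurable[((pastσ X (τ : ℕ) ⊔ coordσ X τ).comap Prod.fst) ⊔
        ((pastσ Y (τ : ℕ)).comap Prod.snd)] a ∧ (∃ M, ∀ ω, |a ω| ≤ M) ∧
      f = fun ω => a ω - ∫ x', a (Function.update ω.1 τ x', ω.2) ∂(Kμ τ ω.1)

open Classical in
/-- Membership in the dual building block `A_{Y,ν,t}` (symmetric to `MemAX`). -/
def MemAY (Kν : ∀ t : Fin N, (∀ s, Y s) → Measure (Y t)) (τ : Fin N)
    (f : (∀ t, X t) × (∀ t, Y t) → ℝ) : Prop :=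
  if (τ : ℕ) = 0 then
    ∃ a : (∀ t, X t) × (∀ t, Y t) → ℝ,
      Measurable[(coordσ Y τ).comap Prod.snd] a ∧ (∃ M, ∀ ω, |a ω| ≤ M) ∧ f = a
  else
    ∃ a : (∀ t, X t) × (∀ t, Y t) → ℝ,
      Measurable[((pastσ X (τ : ℕ)).comap Prod.fst) ⊔
        ((pastσ Y (τ : ℕ) ⊔ coordσ Y τ).comap Prod.snd)] a ∧ (∃ M, ∀ ω, |a ω| ≤ M) ∧
      f = fun ω => a ω - ∫ y', a (ω.1, Function.update ω.2 τ y') ∂(Kν τ ω.2)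

/-- The dual space `S_{X,μ}`: sums `∑_{t=1}^N f_t` with `f_t ∈ A_{X,μ,t}`. -/
def MemSXμ (Kμ : ∀ t : Fin N, (∀ s, X s) → Measure (X t))
    (s : (∀ t, X t) × (∀ t, Y t) → ℝ) : Prop :=
  ∃ f : Fin N → ((∀ t, X t) × (∀ t, Y t) → ℝ),
    (∀ τ, MemAX Kμ τ (f τ)) ∧ s = fun ω => ∑ τ, f τ ω

/-- The dual space `S_{Y,ν}`: sums `∑_{t=1}^N g_t` with `g_t ∈ A_{Y,ν,t}`. -/
def MemSYν (Kν : ∀ t : Fin N, (∀ s, Y s) → Measure (Y t))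
    (s : (∀ t, X t) × (∀ t, Y t) → ℝ) : Prop :=
  ∃ g : Fin N → ((∀ t, X t) × (∀ t, Y t) → ℝ),
    (∀ τ, MemAY Kν τ (g τ)) ∧ s = fun ω => ∑ τ, g τ ω

/-- The space `S_X` of bounded measurable functions depending only on `x`. -/
def MemSX (s : (∀ t, X t) × (∀ t, Y t) → ℝ) : Prop :=
  ∃ g : (∀ t, X t) → ℝ, Measurable g ∧ (∃ M, ∀ x, |g x| ≤ M) ∧ s = fun ω => g ω.1

/-- The space `S_Y` of bounded measurable functions depending only on `y`. -/
def MemSY (s : (∀ t, X t) × (∀ t, Y t) → ℝ) : Prop :=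
  ∃ g : (∀ t, Y t) → ℝ, Measurable g ∧ (∃ M, ∀ y, |g y| ≤ M) ∧ s = fun ω => g ω.2

/-- The dual space `H_•`: `H = S_X ⊕ S_Y`, `H_c = S_{X,μ} ⊕ S_Y`, `H_{ac} = S_X ⊕ S_{Y,ν}`,
`H_{bc} = S_{X,μ} ⊕ S_{Y,ν}`. -/
def MemH (Kμ : ∀ t : Fin N, (∀ s, X s) → Measure (X t))
    (Kν : ∀ t : Fin N, (∀ s, Y s) → Measure (Y t)) :
    Flavor → ((∀ t, X t) × (∀ t, Y t) → ℝ) → Prop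
  | .plain => fun h => ∃ sX sY, MemSX (X := X) (Y := Y) sX ∧ MemSY sY ∧
      h = fun ω => sX ω + sY ω
  | .causal => fun h => ∃ sX sY, MemSXμ Kμ sX ∧ MemSY sY ∧ h = fun ω => sX ω + sY ω
  | .anticausal => fun h => ∃ sX sY, MemSX (X := X) (Y := Y) sX ∧ MemSYν Kν sY ∧
      h = fun ω => sX ω + sY ω
  | .bicausal => fun h => ∃ sX sY, MemSXμ Kμ sX ∧ MemSYν Kν sY ∧ h = fun ω => sX ω + sY ω

/-- The set `Π_c(μ, ∗)` of causal measures with first marginal `μ` and arbitrary second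
marginal. -/
def causalFirst (μ : Measure (∀ t, X t)) : Set (Measure ((∀ t, X t) × (∀ t, Y t))) :=
  {π | π.map Prod.fst = μ ∧ IsCausal π}

/-- The set `Π(∗, ν)` of couplings with arbitrary first marginal and second marginal `ν`. -/
def secondMarg (ν : Measure (∀ t, Y t)) : Set (Measure ((∀ t, X t) × (∀ t, Y t))) :=
  {π | π.map Prod.snd = ν}

/-- The set `Π_{ac}(∗, ν)` of anticausal measures with second marginal `ν`. -/
def anticausalSecond (ν : Measure (∀ t, Y t)) : Set (Measure ((∀ t, X t) × (∀ t, Y t))) :=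
  {π | π.map Prod.snd = ν ∧ IsAnticausal π}

/-- The reference measure `P_c` with `dP_c/dP = exp(-c)/∫ exp(-c) dP`. -/
def Pc {Ω : Type*} [MeasurableSpace Ω] (P : Measure Ω) (c : Ω → ℝ) : Measure Ω :=
  P.withDensity
    (fun ω => ENNReal.ofReal (Real.exp (-c ω)) / ∫⁻ ω', ENNReal.ofReal (Real.exp (-c ω')) ∂P)

/-- Sinkhorn's algorithm: `full 0 = π0`; `half k` is the `D_KL`-projection of `full k`
onto `Q1`, and `full (k+1)` is the `D_KL`-projection of `half k` onto `Q2`. -/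
structure IsSinkhorn {Ω : Type*} [MeasurableSpace Ω] (Q1 Q2 : Set (Measure Ω))
    (π0 : Measure Ω) (full half : ℕ → Measure Ω) : Prop where
  init : full 0 = π0
  half_mem : ∀ k, half k ∈ Q1
  half_opt : ∀ k, ∀ ρ ∈ Q1, KL (half k) (full k) ≤ KL ρ (full k)
  full_mem : ∀ k, full (k + 1) ∈ Q2
  full_opt : ∀ k, ∀ ρ ∈ Q2, KL (full (k + 1)) (half k) ≤ KL ρ (half k)

/-- The second projection set of Sinkhorn's algorithm: `Π(∗, ν)` for the causal problem and
`Π_{ac}(∗, ν)` for the bicausal problem. -/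
def sinkQ2 (b : Flavor) (ν : Measure (∀ t, Y t)) : Set (Measure ((∀ t, X t) × (∀ t, Y t))) :=
  match b with
  | .bicausal => anticausalSecond ν
  | _ => secondMarg ν

/-- The dual class of the second Sinkhorn potential: `S_Y` for the causal problem,
`S_{Y,ν}` for the bicausal problem. -/
def MemG (Kν : ∀ t : Fin N, (∀ s, Y s) → Measure (Y t)) :
    Flavor → ((∀ t, X t) × (∀ t, Y t) → ℝ) → Prop
  | .bicausal => fun g => MemSYν Kν g
  | _ => fun g => MemSY g

/-- Real-valued entropic transport value (`ε = 1`), the infimum being taken over couplings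
with finite relative entropy. -/
def Efin (b : Flavor) (μ : Measure (∀ t, X t)) (ν : Measure (∀ t, Y t))
    (c : (∀ t, X t) × (∀ t, Y t) → ℝ) : ℝ :=
  ⨅ π : {π : Measure ((∀ t, X t) × (∀ t, Y t)) //
      π ∈ aCouplings b μ ν ∧ KL π (μ.prod ν) ≠ ⊤},
    (∫ z, c z ∂π.1 + (KL π.1 (μ.prod ν)).toReal)

/-- A kernel `κ` is nonanticipative for the filtration `F` (up to `ρ`-null sets) if the
probability of any event known at time `s` depends only on what is known of the starting
point at time `s`. -/
def IsNonanticipative {Ω : Type*} [MeasurableSpace Ω] (F : ℕ → MeasurableSpace Ω)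
    (ρ : Measure Ω) (κ : Kernel Ω Ω) : Prop :=
  ∀ s B, MeasurableSet[F s] B → ∃ g : Ω → ℝ≥0∞, Measurable[F s] g ∧ (fun z => κ z B) =ᵐ[ρ] g

/-- `ρ` can be transported to `ρ'` by a nonanticipative Markov kernel moving mass at most `ε`. -/
def NonanticipativelyClose {Ω : Type*} [MeasurableSpace Ω] (F : ℕ → MeasurableSpace Ω)
    (ρ ρ' : Measure Ω) (ε : ℝ≥0∞) : Prop :=
  ∃ κ : Kernel Ω Ω, IsMarkovKernel κ ∧ IsNonanticipative F ρ κ ∧ κ ∘ₘ ρ = ρ' ∧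
    ∫⁻ z, κ z {z}ᶜ ∂ρ ≤ ε

section Nonanticipative

variable {Ω : Type*} {mΩ : MeasurableSpace Ω} {F : ℕ → MeasurableSpace Ω}

lemma measurable_indicator_one {Ω : Type*} {m : MeasurableSpace Ω} {B : Set Ω}
    (hB : MeasurableSet B) : Measurable (B.indicator (1 : Ω → ℝ≥0∞)) :=
  measurable_one.indicator hB

lemma IsNonanticipative.lintegral {ρ : Measure Ω} {κ : Kernel Ω Ω}
    (hF : ∀ t, F t ≤ mΩ) (hκ : IsNonanticipative F ρ κ) {s : ℕ} {g : Ω → ℝ≥0∞}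
    (hg : Measurable[F s] g) :
    ∃ h : Ω → ℝ≥0∞, Measurable[F s] h ∧ (fun z => ∫⁻ y, g y ∂κ z) =ᵐ[ρ] h := by
  refine @Measurable.ennreal_induction Ω (F s) (fun g => ∃ h : Ω → ℝ≥0∞, Measurable[F s] h ∧
    (fun z => ∫⁻ y, g y ∂κ z) =ᵐ[ρ] h) ?_ ?_ ?_ g hg
  · intro c B hB
    obtain ⟨h, hh, hκh⟩ := hκ s B hB
    refine ⟨fun z => c * h z, hh.const_mul c, ?_⟩
    filter_upwards [hκh] with z hz
    rw [lintegral_indicator_const (hF s B hB), hz]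
  · intro f g _ hf hg ihf ihg
    obtain ⟨f', hf', hff'⟩ := ihf
    obtain ⟨g', hg', hgg'⟩ := ihg
    refine ⟨f' + g', hf'.add hg', ?_⟩
    filter_upwards [hff', hgg'] with z h1 h2
    simp only [Pi.add_apply]
    rw [lintegral_add_left (hf.mono (hF s) le_rfl), h1, h2]
  · intro f hf hmono ih
    choose f' hf' hff' using ih
    refine ⟨fun z => ⨆ n, f' n z, Measurable.iSup hf', ?_⟩
    filter_upwards [ae_all_iff.2 hff'] with z hz
    rw [lintegral_iSup (fun n => (hf n).mono (hF s) le_rfl) hmono]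
    exact iSup_congr hz

lemma IsNonanticipative.comp {ρ : Measure Ω} {κ η : Kernel Ω Ω} (hF : ∀ t, F t ≤ mΩ)
    (hκ : IsNonanticipative F ρ κ) (hη : IsNonanticipative F (κ ∘ₘ ρ) η) :
    IsNonanticipative F ρ (η ∘ₖ κ) := by
  intro s B hB
  obtain ⟨g, hg, hηg⟩ := hη s B hB
  obtain ⟨h, hh, hgh⟩ := hκ.lintegral hF hg
  refine ⟨h, hh, ?_⟩
  filter_upwards [Measure.ae_ae_of_ae_comp hηg, hgh] with z h1 h2
  rw [Kernel.comp_apply' _ _ _ (hF s B hB), ← h2]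
  exact lintegral_congr_ae h1

lemma NonanticipativelyClose.refl (hF : ∀ t, F t ≤ mΩ) (ρ : Measure Ω)
    [MeasurableSingletonClass Ω] : NonanticipativelyClose F ρ ρ 0 := by
  refine ⟨Kernel.id, inferInstance, fun s B hB => ⟨B.indicator 1, ?_, ?_⟩, Measure.id_comp, ?_⟩
  · exact measurable_indicator_one hB
  · refine ae_of_all _ fun z => ?_
    simp [Kernel.id_apply, Measure.dirac_apply' _ (hF s B hB)]
  · simp [Kernel.id_apply]

lemma measurable_kernel_compl_singleton (hdiag : MeasurableSet (diagonal Ω)) (κ : Kernel Ω Ω)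
    [IsMarkovKernel κ] : Measurable fun z => κ z {z}ᶜ := by
  have := Kernel.measurable_kernel_prodMk_left (κ := κ) hdiag.compl
  convert this using 3 with z
  ext y
  simp [eq_comm]

lemma NonanticipativelyClose.trans {ρ₁ ρ₂ ρ₃ : Measure Ω} {ε₁ ε₂ : ℝ≥0∞}
    [StandardBorelSpace Ω]
    (hF : ∀ t, F t ≤ mΩ) (h₁₂ : NonanticipativelyClose F ρ₁ ρ₂ ε₁)
    (h₂₃ : NonanticipativelyClose F ρ₂ ρ₃ ε₂) :
    NonanticipativelyClose F ρ₁ ρ₃ (ε₁ + ε₂) := by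
  obtain ⟨κ, _, hκ, rfl, hκε⟩ := h₁₂
  obtain ⟨η, _, hη, rfl, hηε⟩ := h₂₃
  have hdiag : MeasurableSet (diagonal Ω) := measurableSet_diagonal
  refine ⟨η ∘ₖ κ, inferInstance, hκ.comp hF hη, ?_, ?_⟩
  · rw [Measure.comp_assoc]
  have hm := measurable_kernel_compl_singleton hdiag κ
  have hm' := measurable_kernel_compl_singleton hdiag η
  calc ∫⁻ z, (η ∘ₖ κ) z {z}ᶜ ∂ρ₁
      ≤ ∫⁻ z, (κ z {z}ᶜ + ∫⁻ y, η y {y}ᶜ ∂κ z) ∂ρ₁ := by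
        refine lintegral_mono fun z => ?_
        rw [Kernel.comp_apply' _ _ _ (measurableSet_singleton z).compl]
        calc ∫⁻ y, η y {z}ᶜ ∂κ z
            ≤ ∫⁻ y, (({z}ᶜ : Set Ω).indicator 1 y + η y {y}ᶜ) ∂κ z := by
              refine lintegral_mono fun y => ?_
              by_cases hy : y = z
              · subst hy; simp
              · simp only [mem_compl_iff, mem_singleton_iff, hy, not_false_eq_true,
                  indicator_of_mem, Pi.one_apply]
                exact prob_le_one.trans le_self_add
          _ = _ := by
              rw [lintegral_add_right _ hm',
                lintegral_indicator_one (measurableSet_singleton z).compl]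
    _ = ∫⁻ z, κ z {z}ᶜ ∂ρ₁ + ∫⁻ y, η y {y}ᶜ ∂(κ ∘ₘ ρ₁) := by
        rw [lintegral_add_left hm, Measure.lintegral_bind κ.measurable.aemeasurable
          hm'.aemeasurable]
    _ ≤ ε₁ + ε₂ := add_le_add hκε hηε

lemma NonanticipativelyClose.mono {ρ ρ' : Measure Ω} {ε ε' : ℝ≥0∞} (hε : ε ≤ ε')
    (h : NonanticipativelyClose F ρ ρ' ε) : NonanticipativelyClose F ρ ρ' ε' := by
  obtain ⟨κ, h₁, h₂, h₃, h₄⟩ := h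
  exact ⟨κ, h₁, h₂, h₃, h₄.trans hε⟩

/-- Independent sampling is nonanticipative. -/
lemma nonanticipativelyClose_one (ρ ρ' : Measure Ω) [IsProbabilityMeasure ρ]
    [IsProbabilityMeasure ρ'] : NonanticipativelyClose F ρ ρ' 1 := by
  refine ⟨Kernel.const Ω ρ', inferInstance, fun s B _ => ⟨fun _ => ρ' B, measurable_const, ?_⟩,
    ?_, ?_⟩
  · exact ae_of_all _ fun z => by simp
  · simp
  · calc ∫⁻ z, Kernel.const Ω ρ' z {z}ᶜ ∂ρ ≤ ∫⁻ _, 1 ∂ρ := lintegral_mono fun z => prob_le_one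
      _ = 1 := by simp

/-- Resampling a point, with probability `e`, from the conditional distribution of `w` given the
past transports `ρ` to `(1 - e) ρ + w`, if `e ρ` and `w` agree on the past. -/
lemma nonanticipativelyClose_resample [StandardBorelSpace Ω] (hF : ∀ t, F t ≤ mΩ)
    (hmono : Monotone F) (ρ w : Measure Ω) [IsFiniteMeasure w] (t : ℕ)
    {e : Ω → ℝ≥0∞} (he : Measurable[F (t + 1)] e) (he1 : ∀ z, e z ≤ 1)
    (hw : ∀ B, MeasurableSet[F t] B → ∫⁻ z in B, e z ∂ρ = w B) :
    NonanticipativelyClose F ρ (ρ.withDensity (fun z => 1 - e z) + w) (∫⁻ z, e z ∂ρ) := by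
  set G := condExpKernel w (F t) with hG
  have heΩ : Measurable e := he.mono (hF _) le_rfl
  have hGm : ∀ B, MeasurableSet B → Measurable[F t] fun z => G z B :=
    fun B hB => measurable_condExpKernel hB
  have hGmΩ : ∀ B, MeasurableSet B → Measurable fun z => G z B :=
    fun B hB => (hGm B hB).mono (hF _) le_rfl
  let κ : Kernel Ω Ω :=
    ⟨fun z => (1 - e z) • Measure.dirac z + e z • G z,
      Measure.measurable_of_measurable_coe _ fun B hB => by
        have h1 : Measurable fun z => Measure.dirac z B :=
          (Measure.measurable_coe hB).comp Measure.measurable_dirac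
        simp only [Measure.coe_add, Measure.coe_smul, Pi.add_apply, Pi.smul_apply, smul_eq_mul]
        exact ((measurable_const.sub heΩ).mul h1).add (heΩ.mul (hGmΩ B hB))⟩
  have hκ : ∀ z B, MeasurableSet B →
      κ z B = (1 - e z) * B.indicator 1 z + e z * G z B := fun z B hB => by
    change ((1 - e z) • Measure.dirac z + e z • G z) B = _
    simp [Measure.dirac_apply' _ hB]
  have hwtrim : (ρ.withDensity e).trim (hF t) = w.trim (hF t) := by
    refine @Measure.ext _ (F t) _ _ fun B hB => ?_
    rw [trim_measurableSet_eq _ hB, trim_measurableSet_eq _ hB,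
      withDensity_apply _ (hF t B hB), hw B hB]
  have hGint : ∀ B, MeasurableSet B → ∫⁻ z, e z * G z B ∂ρ = w B := fun B hB => by
    calc ∫⁻ z, e z * G z B ∂ρ = ∫⁻ z, G z B ∂(ρ.withDensity e) := by
          rw [lintegral_withDensity_eq_lintegral_mul _ heΩ (hGmΩ B hB)]; rfl
      _ = w B := by
          rw [← lintegral_trim (hF t) (hGm B hB), hwtrim]
          conv_rhs => rw [← condExpKernel_comp_trim (μ := w) (hF t)]
          rw [Measure.bind_apply hB (Kernel.aemeasurable _)]
  have hGpast : ∀ B, MeasurableSet[F t] B → ∀ᵐ z ∂ρ, e z * G z B = e z * B.indicator 1 z := by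
    intro B hB
    have hae : ∀ᵐ z ∂w, G z B = B.indicator 1 z := by
      have h1 := condExpKernel_ae_eq_condExp (μ := w) (hF t) (hF t B hB)
      rw [condExp_of_stronglyMeasurable (hF t) (stronglyMeasurable_const.indicator hB)
        ((integrable_const _).indicator (hF t B hB))] at h1
      filter_upwards [h1] with z hz
      rw [← ENNReal.toReal_eq_toReal_iff' (measure_ne_top _ _)
        (by by_cases h : z ∈ B <;> simp [h])]
      refine hz.trans ?_
      by_cases h : z ∈ B <;> simp [h]
    have hS : MeasurableSet[F t] {z | G z B = B.indicator 1 z} :=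
      measurableSet_eq_fun (hGm B (hF t B hB)) (measurable_indicator_one hB)
    have hae' : ∀ᵐ z ∂(ρ.withDensity e), G z B = B.indicator 1 z := by
      rw [ae_iff] at hae ⊢
      change (ρ.withDensity e) {z | G z B = B.indicator 1 z}ᶜ = 0
      rw [withDensity_apply _ (hF t _ hS.compl), hw _ hS.compl]
      exact hae
    rw [ae_withDensity_iff heΩ] at hae'
    filter_upwards [hae'] with z hz
    by_cases h : e z = 0
    · simp [h]
    · rw [hz h]
  refine ⟨κ, ⟨fun z => ⟨?_⟩⟩, fun s B hB => ?_, ?_, ?_⟩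
  · rw [hκ z _ MeasurableSet.univ]
    simp [tsub_add_cancel_of_le (he1 z)]
  · have hBΩ := hF s B hB
    have hind : Measurable[F s] (B.indicator (1 : Ω → ℝ≥0∞)) := measurable_indicator_one hB
    rcases le_or_gt s t with hst | hst
    · refine ⟨B.indicator 1, hind, ?_⟩
      filter_upwards [hGpast B (hmono hst B hB)] with z hz
      rw [hκ z B hBΩ, hz, ← add_mul, tsub_add_cancel_of_le (he1 z), one_mul]
    · have he' : Measurable[F s] e := he.mono (hmono hst) le_rfl
      have hG' : Measurable[F s] fun z => G z B := (hGm B hBΩ).mono (hmono hst.le) le_rfl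
      exact ⟨fun z => (1 - e z) * B.indicator 1 z + e z * G z B,
        ((measurable_const.sub he').mul hind).add (he'.mul hG'),
        ae_of_all _ fun z => hκ z B hBΩ⟩
  · ext B hB
    have heG : Measurable fun z => e z * G z B := heΩ.mul (hGmΩ B hB)
    rw [Measure.bind_apply hB (Kernel.aemeasurable _), lintegral_congr fun z => hκ z B hB,
      lintegral_add_right _ heG, hGint B hB,
      Measure.add_apply, withDensity_apply _ hB, ← lintegral_indicator hB]
    congr 2
    ext z
    by_cases h : z ∈ B <;> simp [h]
  · refine lintegral_mono fun z => ?_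
    rw [hκ z _ (measurableSet_singleton z).compl]
    simp only [mem_compl_iff, mem_singleton_iff, not_true_eq_false, not_false_eq_true,
      indicator_of_notMem, mul_zero, zero_add]
    exact mul_le_of_le_one_right' prob_le_one

/-- Two densities with respect to `P` that are known at time `t + 1` and give the same mass to
all events known at time `t` define measures that are nonanticipatively close. -/
lemma nonanticipativelyClose_withDensity [StandardBorelSpace Ω] (hF : ∀ t, F t ≤ mΩ)
    (hmono : Monotone F) (P : Measure Ω) (t : ℕ)
    {u v : Ω → ℝ≥0} (hu : Measurable[F (t + 1)] u) (hv : Measurable[F (t + 1)] v)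
    (hufin : ∫⁻ z, u z ∂P ≠ ∞) (hvfin : ∫⁻ z, v z ∂P ≠ ∞)
    (huv : ∀ B, MeasurableSet[F t] B → ∫⁻ z in B, u z ∂P = ∫⁻ z in B, v z ∂P) :
    NonanticipativelyClose F (P.withDensity (fun z => u z)) (P.withDensity (fun z => v z))
      (∫⁻ z, (u z - v z : ℝ≥0∞) ∂P) := by
  let e : Ω → ℝ≥0 := fun z => (u z - v z) / u z
  have hue : ∀ z, u z * e z = u z - v z := fun z => by
    rcases eq_or_ne (u z) 0 with h | h
    · simp [h]
    · exact mul_div_cancel₀ _ h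
  have he : Measurable[F (t + 1)] e := (hu.sub hv).div hu
  have he1 : ∀ z, (e z : ℝ≥0∞) ≤ 1 := fun z => by
    exact_mod_cast div_le_one_of_le₀ tsub_le_self zero_le
  have huΩ : Measurable u := hu.mono (hF _) le_rfl
  have hvΩ : Measurable v := hv.mono (hF _) le_rfl
  have heΩ : Measurable e := he.mono (hF _) le_rfl
  have hwfin : IsFiniteMeasure (P.withDensity fun z => (v z - u z : ℝ≥0∞)) :=
    isFiniteMeasure_withDensity
      ((lintegral_mono fun z => tsub_le_self).trans_lt hvfin.lt_top).ne
  have hset : ∀ B, MeasurableSet B → ∫⁻ z in B, (e z : ℝ≥0∞) ∂(P.withDensity fun z => u z)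
      = ∫⁻ z in B, (u z - v z : ℝ≥0∞) ∂P := fun B hB => by
    rw [restrict_withDensity hB,
      lintegral_withDensity_eq_lintegral_mul _ huΩ.coe_nnreal_ennreal heΩ.coe_nnreal_ennreal]
    refine lintegral_congr fun z => ?_
    simp only [Pi.mul_apply]
    exact_mod_cast hue z
  have key := nonanticipativelyClose_resample hF hmono (P.withDensity fun z => u z)
    (P.withDensity fun z => (v z - u z : ℝ≥0∞)) t he.coe_nnreal_ennreal he1 fun B hB => by
      have hBΩ := hF t B hB
      rw [hset B hBΩ, withDensity_apply _ hBΩ]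
      have hfin : ∫⁻ z in B, (u z : ℝ≥0∞) ∂P ≠ ∞ :=
        ((setLIntegral_le_lintegral _ _).trans_lt hufin.lt_top).ne
      refine (ENNReal.add_right_inj hfin).1 ?_
      conv_lhs => rw [huv B hB]
      rw [← lintegral_add_left hvΩ.coe_nnreal_ennreal, ← lintegral_add_left huΩ.coe_nnreal_ennreal]
      refine lintegral_congr fun z => ?_
      rw [add_tsub_eq_max, add_tsub_eq_max, max_comm]
  convert key using 1
  · ext B hB
    have hm : Measurable fun z => (1 - e z : ℝ≥0∞) :=
      measurable_const.sub heΩ.coe_nnreal_ennreal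
    rw [Measure.add_apply, withDensity_apply _ hB, withDensity_apply _ hB, withDensity_apply _ hB,
      restrict_withDensity hB, lintegral_withDensity_eq_lintegral_mul _ huΩ.coe_nnreal_ennreal hm,
      ← lintegral_add_left (huΩ.coe_nnreal_ennreal.mul hm)]
    refine lintegral_congr fun z => ?_
    have hue' : (u z * e z : ℝ≥0∞) = u z - v z := by exact_mod_cast hue z
    simp only [Pi.mul_apply]
    rw [ENNReal.mul_sub (fun _ _ => ENNReal.coe_ne_top), mul_one, hue']
    rcases le_total (u z) (v z) with h | h
    · have h' : (u z : ℝ≥0∞) ≤ v z := by exact_mod_cast h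
      rw [tsub_eq_zero_of_le h', tsub_zero, add_tsub_cancel_of_le h']
    · have h' : (v z : ℝ≥0∞) ≤ u z := by exact_mod_cast h
      rw [tsub_eq_zero_of_le h', add_zero, ENNReal.sub_sub_cancel ENNReal.coe_ne_top h']
  · have := hset univ MeasurableSet.univ
    simpa using this.symm

lemma exists_density_of_le (π P : Measure Ω) [IsFiniteMeasure π] [IsFiniteMeasure P]
    (hπ : π ≪ P) {m : MeasurableSpace Ω} (hm : m ≤ mΩ) :
    ∃ f : Ω → ℝ≥0, Measurable[m] f ∧
      ∀ B, MeasurableSet[m] B → ∫⁻ z in B, f z ∂P = π B := by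
  have hac : π.trim hm ≪ P.trim hm := hπ.trim hm
  have hmeas : Measurable[m] ((π.trim hm).rnDeriv (P.trim hm)) := Measure.measurable_rnDeriv _ _
  refine ⟨fun z => ((π.trim hm).rnDeriv (P.trim hm) z).toNNReal, hmeas.ennreal_toNNReal,
    fun B hB => ?_⟩
  have hfin : ∀ᵐ z ∂P, (π.trim hm).rnDeriv (P.trim hm) z < ∞ :=
    ae_of_ae_trim hm (Measure.rnDeriv_lt_top _ _)
  rw [← trim_measurableSet_eq hm hB, ← Measure.setLIntegral_rnDeriv hac,
    restrict_trim hm _ hB, lintegral_trim hm hmeas]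
  refine lintegral_congr_ae (ae_restrict_of_ae ?_)
  filter_upwards [hfin] with z hz
  exact ENNReal.coe_toNNReal hz.ne

section TotalVariation

variable {π P : Measure Ω} {m : MeasurableSpace Ω} {f : Ω → ℝ≥0} {δ : ℝ≥0∞}

lemma lintegral_density_sub_one_le [IsFiniteMeasure P] (hm : m ≤ mΩ) (hf : Measurable[m] f)
    (hfπ : ∀ B, MeasurableSet[m] B → ∫⁻ z in B, f z ∂P = π B)
    (hδ : ∀ B, MeasurableSet[mΩ] B → π B ≤ P B + δ) :
    ∫⁻ z, (f z - 1 : ℝ≥0∞) ∂P ≤ δ := by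
  have hS : MeasurableSet[m] {z | (1 : ℝ≥0∞) ≤ f z} :=
    measurableSet_le measurable_const hf.coe_nnreal_ennreal
  set S := {z | (1 : ℝ≥0∞) ≤ f z}
  have hSΩ := hm _ hS
  have h1 : ∫⁻ z, (f z - 1 : ℝ≥0∞) ∂P = ∫⁻ z in S, (f z - 1 : ℝ≥0∞) ∂P := by
    rw [← lintegral_indicator hSΩ]
    refine lintegral_congr fun z => ?_
    by_cases h : z ∈ S
    · rw [indicator_of_mem h]
    · rw [indicator_of_notMem h, tsub_eq_zero_of_le (not_le.1 h).le]
  have h2 : P S + ∫⁻ z in S, (f z - 1 : ℝ≥0∞) ∂P = π S := by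
    rw [← hfπ S hS, ← setLIntegral_one S, ← lintegral_add_left measurable_const]
    exact setLIntegral_congr_fun hSΩ fun z hz => add_tsub_cancel_of_le hz
  rw [h1]
  exact (ENNReal.add_le_add_iff_left (measure_ne_top P S)).1 (h2.trans_le (hδ S hSΩ))

lemma lintegral_one_sub_density_le [IsFiniteMeasure π] (hm : m ≤ mΩ) (hf : Measurable[m] f)
    (hfπ : ∀ B, MeasurableSet[m] B → ∫⁻ z in B, f z ∂P = π B)
    (hδ : ∀ B, MeasurableSet[mΩ] B → P B ≤ π B + δ) :
    ∫⁻ z, (1 - f z : ℝ≥0∞) ∂P ≤ δ := by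
  have hS : MeasurableSet[m] {z | (f z : ℝ≥0∞) ≤ 1} :=
    measurableSet_le hf.coe_nnreal_ennreal measurable_const
  set S := {z | (f z : ℝ≥0∞) ≤ 1}
  have hSΩ := hm _ hS
  have hfΩ : Measurable[mΩ] f := hf.mono hm le_rfl
  have h1 : ∫⁻ z, (1 - f z : ℝ≥0∞) ∂P = ∫⁻ z in S, (1 - f z : ℝ≥0∞) ∂P := by
    rw [← lintegral_indicator hSΩ]
    refine lintegral_congr fun z => ?_
    by_cases h : z ∈ S
    · rw [indicator_of_mem h]
    · rw [indicator_of_notMem h, tsub_eq_zero_of_le (not_le.1 h).le]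
  have h2 : π S + ∫⁻ z in S, (1 - f z : ℝ≥0∞) ∂P = P S := by
    rw [← hfπ S hS, ← setLIntegral_one S, ← lintegral_add_left hfΩ.coe_nnreal_ennreal]
    exact setLIntegral_congr_fun hSΩ fun z hz => add_tsub_cancel_of_le hz
  rw [h1]
  exact (ENNReal.add_le_add_iff_left (measure_ne_top π S)).1 (h2.trans_le (hδ S hSΩ))

end TotalVariation

/-- Measures at total variation distance `δ` are nonanticipatively close in both directions. -/
lemma nonanticipativelyClose_of_totalVariation [StandardBorelSpace Ω] (hF : ∀ t, F t ≤ mΩ)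
    (hmono : Monotone F) (hF0 : F 0 = ⊥) {n : ℕ} (hFn : F n = mΩ) (π P : Measure Ω)
    [IsProbabilityMeasure π] [IsProbabilityMeasure P] (hπ : π ≪ P) {δ : ℝ≥0∞}
    (hδ : ∀ B, MeasurableSet B → π B ≤ P B + δ) (hδ' : ∀ B, MeasurableSet B → P B ≤ π B + δ) :
    NonanticipativelyClose F π P (n * (2 * δ)) ∧ NonanticipativelyClose F P π (n * (2 * δ)) := by
  have hex : ∀ t, ∃ f : Ω → ℝ≥0, Measurable[F t] f ∧
      (∀ B, MeasurableSet[F t] B → ∫⁻ z in B, f z ∂P = π B) ∧ (t = 0 → f = fun _ => 1) := by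
    intro t
    rcases eq_or_ne t 0 with rfl | ht
    · refine ⟨fun _ => 1, measurable_const, fun B hB => ?_, fun _ => rfl⟩
      rw [hF0, MeasurableSpace.measurableSet_bot_iff] at hB
      rcases hB with rfl | rfl <;> simp
    · obtain ⟨f, hf, hfπ⟩ := exists_density_of_le π P hπ (hF t)
      exact ⟨f, hf, hfπ, fun h => absurd h ht⟩
  choose f hf hfπ hf0 using hex
  have hfin : ∀ t, ∫⁻ z, f t z ∂P ≠ ∞ := fun t => by
    have := hfπ t univ MeasurableSet.univ
    rw [setLIntegral_univ] at this
    simp [this]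
  have htri : ∀ {s t} {u v : Ω → ℝ≥0}, Measurable[F s] u → Measurable[F t] v →
      (∀ B, MeasurableSet[F s] B → ∫⁻ z in B, u z ∂P = π B) →
      (∀ B, MeasurableSet[F t] B → ∫⁻ z in B, v z ∂P = π B) →
      ∫⁻ z, (u z - v z : ℝ≥0∞) ∂P ≤ 2 * δ := by
    intro s t u v hu hv huπ hvπ
    have huΩ : Measurable u := hu.mono (hF s) le_rfl
    calc ∫⁻ z, (u z - v z : ℝ≥0∞) ∂P
        ≤ ∫⁻ z, ((u z - 1 : ℝ≥0∞) + (1 - v z : ℝ≥0∞)) ∂P :=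
          lintegral_mono fun z => tsub_le_tsub_add_tsub
      _ = ∫⁻ z, (u z - 1 : ℝ≥0∞) ∂P + ∫⁻ z, (1 - v z : ℝ≥0∞) ∂P :=
          lintegral_add_left (huΩ.coe_nnreal_ennreal.sub measurable_const) _
      _ ≤ δ + δ := add_le_add (lintegral_density_sub_one_le (hF s) hu huπ hδ)
          (lintegral_one_sub_density_le (hF t) hv hvπ hδ')
      _ = 2 * δ := (two_mul δ).symm
  have hagree : ∀ t B, MeasurableSet[F t] B →
      ∫⁻ z in B, f (t + 1) z ∂P = ∫⁻ z in B, f t z ∂P := fun t B hB => by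
    rw [hfπ t B hB, hfπ (t + 1) B (hmono t.le_succ B hB)]
  have hf' : ∀ t, Measurable[F (t + 1)] (f t) := fun t => (hf t).mono (hmono t.le_succ) le_rfl
  have hchain : ∀ t : ℕ,
      NonanticipativelyClose F (P.withDensity fun z => f t z) P (t * (2 * δ)) ∧
      NonanticipativelyClose F P (P.withDensity fun z => f t z) (t * (2 * δ)) := by
    intro t
    induction t with
    | zero =>
      have : (P.withDensity fun z => (f 0 z : ℝ≥0∞)) = P := by
        rw [hf0 0 rfl]
        simp
      rw [this, Nat.cast_zero, zero_mul]
      exact ⟨.refl hF P, .refl hF P⟩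
    | succ t ih =>
      have h₁ := (nonanticipativelyClose_withDensity hF hmono P t (hf (t + 1)) (hf' t)
        (hfin _) (hfin _) (hagree t)).mono (htri (hf _) (hf _) (hfπ _) (hfπ _))
      have h₂ := (nonanticipativelyClose_withDensity hF hmono P t (hf' t) (hf (t + 1))
        (hfin _) (hfin _) fun B hB => (hagree t B hB).symm).mono
          (htri (hf _) (hf _) (hfπ _) (hfπ _))
      have hcast : ((t + 1 : ℕ) : ℝ≥0∞) * (2 * δ) = t * (2 * δ) + 2 * δ := by
        push_cast
        rw [add_mul, one_mul]
      rw [hcast]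
      exact ⟨(h₁.trans hF ih.1).mono (add_comm _ _).le, ih.2.trans hF h₂⟩
  have hn : (P.withDensity fun z => (f n z : ℝ≥0∞)) = π := by
    ext B hB
    rw [withDensity_apply _ hB]
    exact hfπ n B (hFn ▸ hB)
  simpa only [hn] using hchain n

end Nonanticipative

section Pinsker

variable {Ω : Type*} [MeasurableSpace Ω] {π P : Measure Ω} [IsProbabilityMeasure π]
  [IsProbabilityMeasure P]

/-- The Donsker–Varadhan inequality. -/
lemma integral_le_integral_llr_add_log_integral_exp (hπ : π ≪ P) (hint : Integrable (llr π P) π)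
    {f : Ω → ℝ} (hf : Integrable f π) (hexp : Integrable (fun z => Real.exp (f z)) P) :
    ∫ z, f z ∂π ≤ ∫ z, llr π P z ∂π + Real.log (∫ z, Real.exp (f z) ∂P) := by
  have := isProbabilityMeasure_tilted hexp
  have h := InformationTheory.integral_llr_add_sub_measure_univ_nonneg
    (hπ.trans (absolutelyContinuous_tilted hexp)) (integrable_llr_tilted_right hπ hf hint hexp)
  rw [integral_llr_tilted_right hπ hf hexp hint] at h
  simp only [probReal_univ] at h
  linarith

/-- **Pinsker's inequality** for a single event. -/
lemma two_mul_sq_measureReal_sub_le_integral_llr (hπ : π ≪ P) (hint : Integrable (llr π P) π)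
    {B : Set Ω} (hB : MeasurableSet B) :
    2 * (π.real B - P.real B) ^ 2 ≤ ∫ z, llr π P z ∂π := by
  have hX : Measurable (B.indicator (fun _ => (1 : ℝ))) := measurable_const.indicator hB
  have hsub := hasSubgaussianMGF_of_mem_Icc (μ := P) (a := 0) (b := 1) hX.aemeasurable
    (ae_of_all _ fun z => by by_cases h : z ∈ B <;> simp [h])
  have hPB : ∫ z, B.indicator (fun _ => (1 : ℝ)) z ∂P = P.real B := integral_indicator_one hB
  have hπB : ∫ z, B.indicator (fun _ => (1 : ℝ)) z ∂π = π.real B := integral_indicator_one hB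
  rw [hPB] at hsub
  set t : ℝ := 4 * (π.real B - P.real B) with ht
  have hXπ : Integrable (B.indicator (fun _ => (1 : ℝ))) π := (integrable_const _).indicator hB
  have hDV := integral_le_integral_llr_add_log_integral_exp hπ hint
    ((hXπ.sub (integrable_const (P.real B))).const_mul t) (hsub.integrable_exp_mul t)
  have hmgf : Real.log (∫ z, Real.exp (t * (B.indicator (fun _ => (1 : ℝ)) z - P.real B)) ∂P) ≤
      t ^ 2 / 8 := by
    have hpos := integral_exp_pos (hsub.integrable_exp_mul t)
    have := (Real.log_le_iff_le_exp hpos).2 (hsub.mgf_le t)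
    refine this.trans (le_of_eq ?_)
    simp
    ring
  have hmean : ∫ z, t * (B.indicator (fun _ => (1 : ℝ)) z - P.real B) ∂π =
      t * (π.real B - P.real B) := by
    rw [integral_const_mul, integral_sub hXπ (integrable_const _), hπB]
    simp
  simp only [Pi.sub_apply] at hDV
  rw [hmean] at hDV
  nlinarith

lemma ofReal_abs_measureReal_sub_le (hπ : π ≪ P) (hint : Integrable (llr π P) π)
    {B : Set Ω} (hB : MeasurableSet B) :
    ENNReal.ofReal |π.real B - P.real B| ≤ (KL π P / 2) ^ (1 / 2 : ℝ) := by
  rw [one_div, ENNReal.le_rpow_inv_iff two_pos, KL, if_pos ⟨hπ, hint⟩, ENNReal.rpow_two,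
    ← ENNReal.ofReal_pow (abs_nonneg _), sq_abs, ENNReal.le_div_iff_mul_le (by simp) (by simp),
    ← ENNReal.ofReal_ofNat 2, ← ENNReal.ofReal_mul (sq_nonneg _)]
  exact ENNReal.ofReal_le_ofReal
    (by linarith [two_mul_sq_measureReal_sub_le_integral_llr hπ hint hB])

lemma measure_le_add_of_abs_measureReal_sub_le {δ : ℝ≥0∞} {B : Set Ω}
    (h : ENNReal.ofReal |π.real B - P.real B| ≤ δ) : π B ≤ P B + δ := by
  rw [← ofReal_measureReal (μ := π), ← ofReal_measureReal (μ := P)]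
  refine le_trans ?_ (add_le_add_right h _)
  rw [← ENNReal.ofReal_add measureReal_nonneg (abs_nonneg _)]
  exact ENNReal.ofReal_le_ofReal (by linarith [le_abs_self (π.real B - P.real B)])

end Pinsker

section CompProd

variable {Ω : Type*} {m mΩ : MeasurableSpace Ω} {ρ : Measure Ω} [IsProbabilityMeasure ρ]
  {κ : Kernel Ω Ω} [IsMarkovKernel κ]

lemma ae_compProd_of_ae {p : Ω → Prop} (h : ∀ᵐ z ∂ρ, p z) : ∀ᵐ z ∂(ρ ⊗ₘ κ), p z.1 := by
  refine ae_of_ae_map measurable_fst.aemeasurable (p := p) ?_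
  change ∀ᵐ z ∂(ρ ⊗ₘ κ).fst, p z
  rwa [Measure.fst_compProd]

lemma condExp_compProd_indicator_inter (hm : m ≤ mΩ) {A B : Set Ω}
    (hA : MeasurableSet A) (hB : MeasurableSet B) {g : Ω → ℝ≥0∞} (hg : Measurable[m] g)
    (hκ : (fun z => κ z B) =ᵐ[ρ] g) :
    (ρ ⊗ₘ κ)[(Prod.fst ⁻¹' A ∩ Prod.snd ⁻¹' B).indicator (fun _ => (1 : ℝ)) |
        m.comap Prod.fst] =ᵐ[ρ ⊗ₘ κ]
      fun z => (ρ[A.indicator (fun _ => (1 : ℝ)) | m]) z.1 * (g z.1).toReal := by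
  have hmfst : m.comap Prod.fst ≤ (inferInstance : MeasurableSpace (Ω × Ω)) :=
    (MeasurableSpace.comap_mono hm).trans measurable_fst.comap_le
  have hAB : MeasurableSet (Prod.fst ⁻¹' A ∩ Prod.snd ⁻¹' B : Set (Ω × Ω)) := hA.prod hB
  have hint : Integrable (A.indicator (fun _ => (1 : ℝ))) ρ := (integrable_const _).indicator hA
  have hgR : StronglyMeasurable[m] fun z => (g z).toReal := hg.ennreal_toReal.stronglyMeasurable
  have hbound : ∀ᵐ z ∂ρ, ‖(g z).toReal‖ ≤ 1 := by
    filter_upwards [hκ] with z hz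
    rw [← hz, Real.norm_of_nonneg ENNReal.toReal_nonneg]
    exact measureReal_le_one
  have hint' : Integrable (A.indicator (fun _ => (1 : ℝ)) * fun z => (g z).toReal) ρ :=
    hint.mul_bdd (hgR.mono hm).aestronglyMeasurable hbound
  have hpull := condExp_mul_of_stronglyMeasurable_right hgR hint' hint
  set h := ρ[A.indicator (fun _ => (1 : ℝ)) * fun z => (g z).toReal | m]
  have hhm : StronglyMeasurable[m] h := stronglyMeasurable_condExp
  have hh : Integrable h ρ := integrable_condExp
  have hfst : (ρ ⊗ₘ κ).map Prod.fst = ρ := Measure.fst_compProd ρ κ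
  have hhfst : Integrable (fun z : Ω × Ω => h z.1) (ρ ⊗ₘ κ) :=
    (hfst.symm ▸ hh : Integrable h ((ρ ⊗ₘ κ).map Prod.fst)).comp_measurable measurable_fst
  have key : (fun z : Ω × Ω => h z.1) =ᵐ[ρ ⊗ₘ κ]
      (ρ ⊗ₘ κ)[(Prod.fst ⁻¹' A ∩ Prod.snd ⁻¹' B).indicator (fun _ => (1 : ℝ)) |
        m.comap Prod.fst] := by
    refine ae_eq_condExp_of_forall_setIntegral_eq hmfst ((integrable_const _).indicator hAB)
      (fun _ _ _ => hhfst.integrableOn) ?_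
      (hhm.comp_measurable (comap_measurable _)).aestronglyMeasurable
    rintro _ ⟨S, hS, rfl⟩ -
    have hSΩ := hm _ hS
    have hl : ∫ z in Prod.fst ⁻¹' S, h z.1 ∂(ρ ⊗ₘ κ) = ∫ z in S, h z ∂ρ := by
      rw [← setIntegral_map hSΩ (hfst.symm ▸ hh.1) measurable_fst.aemeasurable, hfst]
    have hr : ∫ z in Prod.fst ⁻¹' S, (Prod.fst ⁻¹' A ∩ Prod.snd ⁻¹' B).indicator
        (fun _ => (1 : ℝ)) z ∂(ρ ⊗ₘ κ) = ((ρ ⊗ₘ κ) ((S ∩ A) ×ˢ B)).toReal := by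
      rw [setIntegral_indicator hAB, setIntegral_const, smul_eq_mul, mul_one, ← inter_assoc]
      rfl
    rw [hl, hr, setIntegral_condExp hm hint' hS, Measure.compProd_apply_prod (hSΩ.inter hA) hB,
      ← integral_toReal (κ.measurable_coe hB).aemeasurable
        (ae_of_all _ fun _ => measure_lt_top _ _),
      ← setIntegral_indicator hA]
    refine setIntegral_congr_ae hSΩ ?_
    filter_upwards [hκ] with z hz _
    by_cases hzA : z ∈ A <;> simp [hzA, hz]
  exact key.symm.trans (ae_compProd_of_ae hpull)

/-- The coupling of `ρ` and its image under a nonanticipative kernel is causal. -/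
lemma IsNonanticipative.isCausalFor {N : ℕ} {m : Fin N → MeasurableSpace Ω} (hm : ∀ t, m t ≤ mΩ)
    (hκ : IsNonanticipative (pastσOf m) ρ κ) : IsCausalFor m m (ρ ⊗ₘ κ) := by
  have hpast : ∀ t, pastσOf m t ≤ mΩ := fun t => iSup₂_le fun s _ => hm s
  rintro t _ _ ⟨A, hA, rfl⟩ ⟨B, hB, rfl⟩
  obtain ⟨g, hg, hκg⟩ := hκ t B hB
  have hAΩ := hm t A hA
  have hBΩ := hpast t B hB
  have hAB := condExp_compProd_indicator_inter (hpast t) hAΩ hBΩ hg hκg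
  have hA' := condExp_compProd_indicator_inter (κ := κ) (ρ := ρ) (hpast t) hAΩ .univ
    (measurable_const (a := 1)) (ae_of_all _ fun z => measure_univ)
  have hB' := condExp_compProd_indicator_inter (hpast t) .univ hBΩ hg hκg
  rw [preimage_univ, inter_univ] at hA'
  rw [preimage_univ, univ_inter, indicator_univ, condExp_const (hpast t)] at hB'
  filter_upwards [hAB, hA', hB'] with z h1 h2 h3
  rw [h1, Pi.mul_apply, h2, h3]
  simp

end CompProd

section Cost

variable {A B : Type*} [MeasurableSpace A] [MeasurableSpace B] [EMetricSpace A] [EMetricSpace B]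

lemma lcost2_le {p : ℝ} (hp : 1 ≤ p) {D : ℝ≥0∞}
    (hD : ∀ z w : A × B, edist z.1 w.1 + edist z.2 w.2 ≤ D)
    (hdiag : MeasurableSet (diagonal (A × B))) (θ : Measure ((A × B) × (A × B))) :
    lcost2 p θ ≤ D ^ p * θ (diagonal (A × B))ᶜ := by
  rw [lcost2, ← lintegral_indicator_const hdiag.compl]
  refine lintegral_mono fun z => ?_
  have hp0 : 0 < p := by linarith
  by_cases hz : z ∈ (diagonal (A × B))ᶜ
  · rw [indicator_of_mem hz]
    exact (ENNReal.add_rpow_le_rpow_add _ _ hp).trans (ENNReal.rpow_le_rpow (hD _ _) hp0.le)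
  · have hz' : z.1 = z.2 := not_not.1 hz
    simp [hz', hp0]

lemma lcost2_map_swap (p : ℝ) (θ : Measure ((A × B) × (A × B))) :
    lcost2 p (θ.map Prod.swap) = lcost2 p θ := by
  change ∫⁻ z, _ ∂(θ.map MeasurableEquiv.prodComm) = _
  rw [lintegral_map_equiv]
  refine lintegral_congr fun z => ?_
  rw [edist_comm z.1.1, edist_comm z.1.2]
  rfl

lemma compProd_compl_diagonal {Ω : Type*} [MeasurableSpace Ω] (hdiag : MeasurableSet (diagonal Ω))
    (ρ : Measure Ω) [SFinite ρ] (κ : Kernel Ω Ω) [IsSFiniteKernel κ] :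
    (ρ ⊗ₘ κ) (diagonal Ω)ᶜ = ∫⁻ z, κ z {z}ᶜ ∂ρ := by
  rw [Measure.compProd_apply hdiag.compl]
  refine lintegral_congr fun z => ?_
  congr 1
  ext y
  simp [eq_comm]

end Cost

section PathSpace

variable {N : ℕ} {X Y : Fin N → Type*} [∀ t, MeasurableSpace (X t)] [∀ t, MeasurableSpace (Y t)]

lemma pastσOf_mono {Ω : Type*} (m : Fin N → MeasurableSpace Ω) : Monotone (pastσOf m) :=
  fun _ _ hst => iSup_mono fun _ => iSup_const_mono fun h => h.trans_le hst

lemma pastσOf_zero {Ω : Type*} (m : Fin N → MeasurableSpace Ω) : pastσOf m 0 = ⊥ := by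
  simp [pastσOf]

lemma pastσOf_length {Ω : Type*} (m : Fin N → MeasurableSpace Ω) : pastσOf m N = ⨆ t, m t := by
  simp [pastσOf]

lemma iSup_coordσ : ⨆ t, coordσ X t = MeasurableSpace.pi := rfl

lemma iSup_coordσ2 : ⨆ t, coordσ2 X Y t = Prod.instMeasurableSpace := by
  simp only [coordσ2, iSup_sup_eq, ← MeasurableSpace.comap_iSup, iSup_coordσ]
  rfl

lemma coordσ2_le (t : Fin N) : coordσ2 X Y t ≤ Prod.instMeasurableSpace :=
  (le_iSup (coordσ2 X Y) t).trans_eq iSup_coordσ2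

lemma pastσOf_coordσ2_le (t : ℕ) : pastσOf (coordσ2 X Y) t ≤ Prod.instMeasurableSpace :=
  iSup₂_le fun s _ => coordσ2_le s

end PathSpace

section Wasserstein

variable {N : ℕ} {X Y : Fin N → Type*} [∀ t, MeasurableSpace (X t)] [∀ t, MeasurableSpace (Y t)]
  [∀ t, EMetricSpace (X t)] [∀ t, EMetricSpace (Y t)]
  {π π' : Measure ((∀ t, X t) × (∀ t, Y t))} {p : ℝ} {D ε : ℝ≥0∞}

lemma W2_le_of_mem {b : Flavor} (hp : 1 ≤ p)
    {θ : Measure (((∀ t, X t) × (∀ t, Y t)) × ((∀ t, X t) × (∀ t, Y t)))}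
    (hθ : θ ∈ aCouplings2 b π π') (hcost : lcost2 p θ ≤ D ^ p * ε) :
    W2 p b π π' ≤ D * ε ^ (1 / p) := by
  have hp0 : 0 < p := by linarith
  calc W2 p b π π' ≤ (D ^ p * ε) ^ (1 / p) :=
        ENNReal.rpow_le_rpow ((iInf_le _ ⟨θ, hθ⟩).trans hcost) (by positivity)
    _ = D * ε ^ (1 / p) := by
        rw [ENNReal.mul_rpow_of_nonneg _ _ (by positivity), ← ENNReal.rpow_mul,
          mul_one_div_cancel hp0.ne', ENNReal.rpow_one]

lemma NonanticipativelyClose.W2_causal_le [IsProbabilityMeasure π]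
    (h : NonanticipativelyClose (pastσOf (coordσ2 X Y)) π π' ε) (hp : 1 ≤ p)
    (hD : ∀ z w : (∀ t, X t) × (∀ t, Y t), edist z.1 w.1 + edist z.2 w.2 ≤ D)
    (hdiag : MeasurableSet (diagonal ((∀ t, X t) × (∀ t, Y t)))) :
    W2 p .causal π π' ≤ D * ε ^ (1 / p) := by
  obtain ⟨κ, hκ, hna, hcomp, hε⟩ := h
  refine W2_le_of_mem (θ := π ⊗ₘ κ) hp
    ⟨⟨Measure.fst_compProd π κ, (Measure.snd_compProd π κ).trans hcomp⟩,
      hna.isCausalFor coordσ2_le⟩ ((lcost2_le hp hD hdiag _).trans ?_)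
  rw [compProd_compl_diagonal hdiag]
  gcongr

lemma NonanticipativelyClose.W2_anticausal_le [IsProbabilityMeasure π']
    (h : NonanticipativelyClose (pastσOf (coordσ2 X Y)) π' π ε) (hp : 1 ≤ p)
    (hD : ∀ z w : (∀ t, X t) × (∀ t, Y t), edist z.1 w.1 + edist z.2 w.2 ≤ D)
    (hdiag : MeasurableSet (diagonal ((∀ t, X t) × (∀ t, Y t)))) :
    W2 p .anticausal π π' ≤ D * ε ^ (1 / p) := by
  obtain ⟨κ, hκ, hna, hcomp, hε⟩ := h
  refine W2_le_of_mem (θ := (π' ⊗ₘ κ).map Prod.swap) hp ⟨⟨?_, ?_⟩, ?_⟩ ?_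
  · rw [Measure.map_map measurable_fst measurable_swap]
    exact (Measure.snd_compProd π' κ).trans hcomp
  · rw [Measure.map_map measurable_snd measurable_swap]
    exact Measure.fst_compProd π' κ
  · change IsCausalFor _ _ (((π' ⊗ₘ κ).map Prod.swap).map Prod.swap)
    rw [Measure.map_map measurable_swap measurable_swap, Prod.swap_swap_eq, Measure.map_id]
    exact hna.isCausalFor coordσ2_le
  · rw [lcost2_map_swap]
    refine (lcost2_le hp hD hdiag _).trans ?_
    rw [compProd_compl_diagonal hdiag]
    gcongr

end Wasserstein

lemma two_mul_le_two_pow (n : ℕ) : 2 * n ≤ 2 ^ n := by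
  induction n with
  | zero => simp
  | succ n ih =>
    rcases n with _ | n
    · simp
    · have := Nat.one_le_two_pow (n := n)
      rw [pow_succ] at ih ⊢
      omega

/-- If `diam(X × Y) < ∞`, then any `μ, ν` satisfy the adapted
transport-entropy inequality `T_a(p, C_p)` with
`C_p = diam(X × Y) · 2^{N/p} · 2^{-1/(2p)}`: for all couplings `π, π̃ ∈ Π(μ, ν)`,
`max{W_{p,c}(π, π̃), W_{p,ac}(π, π̃)} ≤ C_p D_KL(π, π̃)^{1/(2p)}`. -/
theorem stmt_6 {N : ℕ} (X Y : Fin N → Type*)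
    [∀ t, MeasurableSpace (X t)] [∀ t, MetricSpace (X t)]
    [∀ t, PolishSpace (X t)] [∀ t, BorelSpace (X t)]
    [∀ t, MeasurableSpace (Y t)] [∀ t, MetricSpace (Y t)]
    [∀ t, PolishSpace (Y t)] [∀ t, BorelSpace (Y t)]
    (p : ℝ) (hp : 1 ≤ p)
    (D : ℝ≥0∞)
    (hD : D = ⨆ z : ((∀ t, X t) × (∀ t, Y t)) × ((∀ t, X t) × (∀ t, Y t)),
      (edist z.1.1 z.2.1 + edist z.1.2 z.2.2))
    (hDfin : D ≠ ⊤)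
    (μ : Measure (∀ t, X t)) (ν : Measure (∀ t, Y t))
    [IsProbabilityMeasure μ] [IsProbabilityMeasure ν]
    (π π' : Measure ((∀ t, X t) × (∀ t, Y t)))
    (hπ : π ∈ aCouplings .plain μ ν) (hπ' : π' ∈ aCouplings .plain μ ν) :
    max (W2 p .causal π π') (W2 p .anticausal π π') ≤
      (D * (2 : ℝ≥0∞) ^ ((N : ℝ) / p) * (2 : ℝ≥0∞) ^ (-(1 / (2 * p)))) *
        KL π π' ^ (1 / (2 * p)) := by
  have hD' : ∀ z w : (∀ t, X t) × (∀ t, Y t), edist z.1 w.1 + edist z.2 w.2 ≤ D := fun z w =>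
    hD ▸ le_iSup (fun z : ((∀ t, X t) × (∀ t, Y t)) × ((∀ t, X t) × (∀ t, Y t)) =>
      edist z.1.1 z.2.1 + edist z.1.2 z.2.2) (z, w)
  have hdiag : MeasurableSet (diagonal ((∀ t, X t) × (∀ t, Y t))) := measurableSet_diagonal
  have hp0 : 0 < p := by linarith
  have : IsProbabilityMeasure π :=
    ⟨by rw [← preimage_univ (f := Prod.fst), ← Measure.map_apply measurable_fst .univ, hπ.1.1,
      measure_univ]⟩
  have : IsProbabilityMeasure π' :=
    ⟨by rw [← preimage_univ (f := Prod.fst), ← Measure.map_apply measurable_fst .univ, hπ'.1.1,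
      measure_univ]⟩
  by_cases hfin : π ≪ π' ∧ Integrable (llr π π') π
  · obtain ⟨hac, hint⟩ := hfin
    set δ := (KL π π' / 2) ^ (1 / 2 : ℝ) with hδ
    obtain ⟨h, h'⟩ := nonanticipativelyClose_of_totalVariation pastσOf_coordσ2_le (pastσOf_mono _)
      (pastσOf_zero _) ((pastσOf_length _).trans iSup_coordσ2) π π' hac (δ := δ)
      (fun B hB => measure_le_add_of_abs_measureReal_sub_le
        (ofReal_abs_measureReal_sub_le hac hint hB))
      (fun B hB => measure_le_add_of_abs_measureReal_sub_le
        (abs_sub_comm (π.real B) _ ▸ ofReal_abs_measureReal_sub_le hac hint hB))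
    have hNδ : (N : ℝ≥0∞) * (2 * δ) ≤ 2 ^ N * δ := by
      rw [← mul_assoc, mul_comm (N : ℝ≥0∞)]
      gcongr
      exact_mod_cast two_mul_le_two_pow N
    have hconst : D * (2 ^ N * δ) ^ (1 / p) = (D * (2 : ℝ≥0∞) ^ ((N : ℝ) / p) *
        (2 : ℝ≥0∞) ^ (-(1 / (2 * p)))) * KL π π' ^ (1 / (2 * p)) := by
      rw [hδ, ENNReal.mul_rpow_of_nonneg _ _ (by positivity), ← ENNReal.rpow_natCast,
        ← ENNReal.rpow_mul, ← ENNReal.rpow_mul, mul_one_div, one_div_mul_one_div,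
        ENNReal.div_rpow_of_nonneg _ _ (by positivity), ENNReal.rpow_neg, ENNReal.div_eq_inv_mul]
      ring
    rw [← hconst]
    exact max_le ((h.mono hNδ).W2_causal_le hp hD' hdiag)
      ((h'.mono hNδ).W2_anticausal_le hp hD' hdiag)
  · have hle : max (W2 p .causal π π') (W2 p .anticausal π π') ≤ D * 1 ^ (1 / p) :=
      max_le ((nonanticipativelyClose_one π π').W2_causal_le hp hD' hdiag)
        ((nonanticipativelyClose_one π' π).W2_anticausal_le hp hD' hdiag)
    rcases eq_or_ne D 0 with rfl | hD0
    · simpa using hle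
    · rw [KL, if_neg hfin, ENNReal.top_rpow_of_pos (by positivity), ENNReal.mul_top]
      · exact le_top
      · simp [hD0]

end AOT
end
end

section
/- Let p ∈ [1, ∞), let c : X × Y → ℝ be continuous with growth of order at most p, and let μ^n ∈ P_p(X), ν^n ∈ P_p(Y) converge to μ ∈ P_p(X), ν ∈ P_p(Y) in the bicausal Wasserstein distance W_{p,bc}. Then V_•(μ^n, ν^n, c) → V_•(μ, ν, c) as n → ∞, and every accumulation point (with respect to weak convergence) of a sequence of optimizers of V_•(μ^n, ν^n, c) is an optimizer of V_•(μ, ν, c), where • stands for any of: no constraint, causal, anticausal, or bicausal. -/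
open MeasureTheory ProbabilityTheory Filter Set
open scoped ENNReal NNReal Topology ProbabilityTheory

noncomputable section

namespace AOT

variable {N : ℕ}

variable {X Y : Fin N → Type*} [∀ t, MeasurableSpace (X t)] [∀ t, MeasurableSpace (Y t)]

/-- If `h` is `m₃`-measurable and has the same integrals as `f` over all sets `A ∩ C` with
`A ∈ m₁` and `C ∈ m₃`, then `h` is the conditional expectation of `f` given `m₁ ⊔ m₃`. -/
theorem ae_eq_condExp_sup {Ω : Type*} {m₁ m₃ mΩ : MeasurableSpace Ω} (h₁ : m₁ ≤ mΩ)
    (h₃ : m₃ ≤ mΩ) {P : Measure Ω} [IsProbabilityMeasure P] {f h : Ω → ℝ}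
    (hf : Integrable f P) (hh : Integrable h P) (hm : AEStronglyMeasurable[m₃] h P)
    (H : ∀ A C, MeasurableSet[m₁] A → MeasurableSet[m₃] C →
      ∫ ω in A ∩ C, f ω ∂P = ∫ ω in A ∩ C, h ω ∂P) :
    h =ᵐ[P] P[f | m₁ ⊔ m₃] := by
  have h13 : m₁ ⊔ m₃ ≤ mΩ := sup_le h₁ h₃
  refine ae_eq_condExp_of_forall_setIntegral_eq h13 hf (fun s _ _ => hh.integrableOn)
    (fun s hs _ => ?_) (hm.mono (le_sup_right : m₃ ≤ m₁ ⊔ m₃))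
  have hgen : m₁ ⊔ m₃ = MeasurableSpace.generateFrom
      {s | ∃ A C, MeasurableSet[m₁] A ∧ MeasurableSet[m₃] C ∧ s = A ∩ C} := by
    apply le_antisymm
    · refine sup_le (fun A hA => ?_) (fun C hC => ?_)
      · exact MeasurableSpace.measurableSet_generateFrom
          ⟨A, univ, hA, @MeasurableSet.univ _ m₃, (inter_univ A).symm⟩
      · exact MeasurableSpace.measurableSet_generateFrom
          ⟨univ, C, @MeasurableSet.univ _ m₁, hC, (univ_inter C).symm⟩
    · refine MeasurableSpace.generateFrom_le ?_
      rintro s ⟨A, C, hA, hC, rfl⟩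
      exact MeasurableSet.inter ((le_sup_left : m₁ ≤ m₁ ⊔ m₃) _ hA)
        ((le_sup_right : m₃ ≤ m₁ ⊔ m₃) _ hC)
  have huniv : ∫ ω, h ω ∂P = ∫ ω, f ω ∂P := by
    have := H univ univ (@MeasurableSet.univ _ m₁) (@MeasurableSet.univ _ m₃)
    simpa using this.symm
  induction s, hs using MeasurableSpace.induction_on_inter hgen with
  | h_inter =>
    rintro s ⟨A, C, hA, hC, rfl⟩ t ⟨A', C', hA', hC', rfl⟩ -
    exact ⟨A ∩ A', C ∩ C', MeasurableSet.inter hA hA', MeasurableSet.inter hC hC',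
      inter_inter_inter_comm _ _ _ _⟩
  | empty => simp
  | basic t ht =>
    obtain ⟨A, C, hA, hC, rfl⟩ := ht
    exact (H A C hA hC).symm
  | compl t ht ih =>
    have e1 := integral_add_compl (h13 _ ht) hf
    have e2 := integral_add_compl (h13 _ ht) hh
    have := ih (measure_lt_top _ _)
    linarith
  | iUnion t hd ht ih =>
    rw [integral_iUnion (fun i => h13 _ (ht i)) hd hf.integrableOn,
      integral_iUnion (fun i => h13 _ (ht i)) hd hh.integrableOn]
    exact tsum_congr fun i => ih i (measure_lt_top _ _)

/-- Conditional independence of `m₁` and `m₂` given `m₃`, in the asymmetric form: conditioning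
events of `m₂` on `m₁ ⊔ m₃` is the same as conditioning them on `m₃`. -/
def CondExpIndep {Ω : Type*} {mΩ : MeasurableSpace Ω} (m₁ m₂ m₃ : MeasurableSpace Ω)
    (P : @Measure Ω mΩ) : Prop :=
  ∀ B : Set Ω, MeasurableSet[m₂] B →
    (P[B.indicator (fun _ => (1 : ℝ)) | m₁ ⊔ m₃]) =ᵐ[P] P[B.indicator (fun _ => (1 : ℝ)) | m₃]

section Semigraphoid

variable {Ω : Type*} {m₁ m₂ m₃ m₄ mΩ : MeasurableSpace Ω} {P : Measure Ω}

theorem integrable_indicator_one_mul {B : Set Ω} (hB : MeasurableSet B) {f : Ω → ℝ}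
    (hf : Integrable f P) : Integrable (fun ω => B.indicator (fun _ => (1 : ℝ)) ω * f ω) P := by
  have : (fun ω => B.indicator (fun _ => (1 : ℝ)) ω * f ω) = B.indicator f := by
    ext ω; by_cases h : ω ∈ B <;> simp [h]
  rw [this]; exact hf.indicator hB

theorem CondIndepσ.symm (H : CondIndepσ m₁ m₂ m₃ P) : CondIndepσ m₂ m₁ m₃ P := by
  intro A B hA hB
  rw [inter_comm, mul_comm]
  exact H B A hB hA

theorem CondExpIndep.mono_right (H : CondExpIndep m₁ m₂ m₃ P) (h : m₄ ≤ m₂) :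
    CondExpIndep m₁ m₄ m₃ P := fun B hB => H B (h _ hB)

theorem CondExpIndep.contract (H : CondExpIndep m₁ m₂ m₃ P)
    (H' : CondExpIndep m₄ m₂ (m₁ ⊔ m₃) P) : CondExpIndep (m₄ ⊔ m₁) m₂ m₃ P := by
  intro B hB
  rw [sup_assoc]
  exact (H' B hB).trans (H B hB)

variable [IsProbabilityMeasure P]

theorem integrable_indicator_one {B : Set Ω} (hB : MeasurableSet B) :
    Integrable (B.indicator (fun _ => (1 : ℝ))) P :=
  (integrable_const 1).indicator hB

theorem condExpIndep_iff (h₁ : m₁ ≤ mΩ) (h₂ : m₂ ≤ mΩ) (h₃ : m₃ ≤ mΩ) :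
    CondExpIndep m₁ m₂ m₃ P ↔ CondIndepσ m₁ m₂ m₃ P := by
  have h13 : m₁ ⊔ m₃ ≤ mΩ := sup_le h₁ h₃
  constructor
  · intro H A B hA hB
    have hA' := h₁ _ hA
    have hB' := h₂ _ hB
    set a := A.indicator (fun _ => (1 : ℝ)) with ha
    set b := B.indicator (fun _ => (1 : ℝ)) with hb
    have hab : (A ∩ B).indicator (fun _ => (1 : ℝ)) = a * b := by
      ext ω; by_cases h : ω ∈ A <;> by_cases h' : ω ∈ B <;> simp [ha, hb, h, h']
    have hai : Integrable a P := integrable_indicator_one hA'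
    have hbi : Integrable b P := integrable_indicator_one hB'
    have habi : Integrable (a * b) P := integrable_indicator_one_mul hA' hbi
    have haci : Integrable (a * P[b | m₃]) P := integrable_indicator_one_mul hA' integrable_condExp
    have hasm : StronglyMeasurable[m₁ ⊔ m₃] a :=
      StronglyMeasurable.indicator (@stronglyMeasurable_const _ _ (m₁ ⊔ m₃) _ _)
        ((le_sup_left : m₁ ≤ m₁ ⊔ m₃) _ hA)
    rw [hab]
    calc P[a * b | m₃] =ᵐ[P] P[P[a * b | m₁ ⊔ m₃] | m₃] :=
          (condExp_condExp_of_le le_sup_right h13).symm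
      _ =ᵐ[P] P[a * P[b | m₁ ⊔ m₃] | m₃] :=
          condExp_congr_ae (condExp_mul_of_stronglyMeasurable_left hasm habi hbi)
      _ =ᵐ[P] P[a * P[b | m₃] | m₃] := condExp_congr_ae ((EventuallyEq.refl _ a).mul (H B hB))
      _ =ᵐ[P] P[a | m₃] * P[b | m₃] :=
          condExp_mul_of_stronglyMeasurable_right stronglyMeasurable_condExp haci hai
  · intro H B hB
    have hB' := h₂ _ hB
    have hbi : Integrable (B.indicator (fun _ => (1 : ℝ))) P := integrable_indicator_one hB'
    refine (ae_eq_condExp_sup h₁ h₃ hbi integrable_condExp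
      stronglyMeasurable_condExp.aestronglyMeasurable fun A C hA hC => ?_).symm
    have hA' := h₁ _ hA
    set a := A.indicator (fun _ => (1 : ℝ)) with ha
    set b := B.indicator (fun _ => (1 : ℝ)) with hb
    have hab : (A ∩ B).indicator (fun _ => (1 : ℝ)) = a * b := by
      ext ω; by_cases h : ω ∈ A <;> by_cases h' : ω ∈ B <;> simp [ha, hb, h, h']
    have hai : Integrable a P := integrable_indicator_one hA'
    have habi : Integrable (a * b) P := integrable_indicator_one_mul hA' hbi
    have haci : Integrable (a * P[b | m₃]) P := integrable_indicator_one_mul hA' integrable_condExp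
    have key : P[a * b | m₃] =ᵐ[P] P[a * P[b | m₃] | m₃] := by
      have := H A B hA hB
      rw [hab] at this
      exact this.trans
        (condExp_mul_of_stronglyMeasurable_right stronglyMeasurable_condExp haci hai).symm
    have e : ∀ f : Ω → ℝ, ∫ ω in A ∩ C, f ω ∂P = ∫ ω in C, (a * f) ω ∂P := by
      intro f
      rw [inter_comm, ← setIntegral_indicator hA']
      congr 1; ext ω; by_cases h : ω ∈ A <;> simp [ha, h]
    rw [e, e, ← setIntegral_condExp h₃ habi hC, ← setIntegral_condExp h₃ haci hC]
    exact integral_congr_ae (ae_restrict_of_ae key)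

theorem CondExpIndep.symm (h₁ : m₁ ≤ mΩ) (h₂ : m₂ ≤ mΩ) (h₃ : m₃ ≤ mΩ)
    (H : CondExpIndep m₁ m₂ m₃ P) : CondExpIndep m₂ m₁ m₃ P :=
  (condExpIndep_iff h₂ h₁ h₃).2 ((condExpIndep_iff h₁ h₂ h₃).1 H).symm

theorem CondExpIndep.weak_union (h₁ : m₁ ≤ mΩ) (h₃ : m₃ ≤ mΩ)
    (H : CondExpIndep m₁ m₂ m₃ P) (h : m₄ ≤ m₁) :
    CondExpIndep m₁ m₂ (m₃ ⊔ m₄) P := by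
  intro B hB
  have h13 : m₁ ⊔ m₃ ≤ mΩ := sup_le h₁ h₃
  have e : m₁ ⊔ (m₃ ⊔ m₄) = m₁ ⊔ m₃ :=
    le_antisymm (sup_le le_sup_left (sup_le le_sup_right (h.trans le_sup_left)))
      (sup_le le_sup_left (le_sup_left.trans le_sup_right))
  have hle : m₃ ⊔ m₄ ≤ m₁ ⊔ m₃ := sup_le le_sup_right (h.trans le_sup_left)
  rw [e]
  refine (H B hB).trans ?_
  have e1 : P[P[B.indicator (fun _ => (1 : ℝ)) | m₃] | m₃ ⊔ m₄]
      = P[B.indicator (fun _ => (1 : ℝ)) | m₃] :=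
    condExp_of_stronglyMeasurable (hle.trans h13)
      (stronglyMeasurable_condExp.mono le_sup_left) integrable_condExp
  calc P[B.indicator (fun _ => (1 : ℝ)) | m₃]
      = P[P[B.indicator (fun _ => (1 : ℝ)) | m₃] | m₃ ⊔ m₄] := e1.symm
    _ =ᵐ[P] P[P[B.indicator (fun _ => (1 : ℝ)) | m₁ ⊔ m₃] | m₃ ⊔ m₄] :=
        condExp_congr_ae (H B hB).symm
    _ =ᵐ[P] P[B.indicator (fun _ => (1 : ℝ)) | m₃ ⊔ m₄] := condExp_condExp_of_le hle h13

theorem CondExpIndep.mono_left (h₁ : m₁ ≤ mΩ) (h₃ : m₃ ≤ mΩ)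
    (H : CondExpIndep m₁ m₂ m₃ P) (h : m₄ ≤ m₁) : CondExpIndep m₄ m₂ m₃ P := by
  intro B hB
  rw [sup_comm]
  have e : m₁ ⊔ (m₃ ⊔ m₄) = m₁ ⊔ m₃ :=
    le_antisymm (sup_le le_sup_left (sup_le le_sup_right (h.trans le_sup_left)))
      (sup_le le_sup_left (le_sup_left.trans le_sup_right))
  have := H.weak_union h₁ h₃ h B hB
  rw [e] at this
  exact this.symm.trans (H B hB)

end Semigraphoid

theorem pastσOf_mono_s7 {A : Type*} (m : Fin N → MeasurableSpace A) {s t : ℕ} (h : s ≤ t) :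
    pastσOf m s ≤ pastσOf m t :=
  iSup_le fun i => iSup_le fun hi =>
    le_iSup_of_le i (le_iSup_of_le (hi.trans_le h) le_rfl)

theorem le_pastσOf {A : Type*} (m : Fin N → MeasurableSpace A) {s : Fin N} {t : ℕ}
    (h : (s : ℕ) < t) : m s ≤ pastσOf m t :=
  le_iSup_of_le s (le_iSup_of_le h le_rfl)

theorem pastσOf_le_iSup {A : Type*} (m : Fin N → MeasurableSpace A) (t : ℕ) :
    pastσOf m t ≤ ⨆ s, m s :=
  iSup_le fun i => iSup_le fun _ => le_iSup m i

theorem iSup_le_pastσOf {A : Type*} (m : Fin N → MeasurableSpace A) :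
    ⨆ s, m s ≤ pastσOf m N :=
  iSup_le fun i => le_pastσOf m i.2

theorem pastσOf_succ_le {A : Type*} (m : Fin N → MeasurableSpace A) (t : Fin N) :
    pastσOf m (t + 1) ≤ m t ⊔ pastσOf m t := by
  refine iSup_le fun i => iSup_le fun hi => ?_
  rcases Nat.lt_succ_iff_lt_or_eq.1 hi with h | h
  · exact (le_pastσOf m h).trans le_sup_right
  · rw [Fin.ext h]; exact le_sup_left

theorem pastσOf_comap {A B : Type*} (m : Fin N → MeasurableSpace A) (f : B → A) (t : ℕ) :
    (pastσOf m t).comap f = pastσOf (fun s => (m s).comap f) t := by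
  simp only [pastσOf, MeasurableSpace.comap_iSup]

section Causal

variable {Ω : Type*} {mΩ : MeasurableSpace Ω} {P : Measure Ω} [IsProbabilityMeasure P]

/-- Causality between two filtrations on a common probability space: the `t`-th increment of
the first is independent of the past of the second given the past of the first. -/
def CausalOn (P : Measure Ω) (a b : Fin N → MeasurableSpace Ω) : Prop :=
  ∀ t : Fin N, CondExpIndep (a t) (pastσOf b t) (pastσOf a t) P

theorem CausalOn.condExpIndep_iSup {a b : Fin N → MeasurableSpace Ω} (ha : ∀ t, a t ≤ mΩ)
    (H : CausalOn P a b) (t : Fin N) :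
    CondExpIndep (⨆ s, a s) (pastσOf b t) (pastσOf a t) P := by
  have hple : ∀ k, pastσOf a k ≤ mΩ := fun k => (pastσOf_le_iSup a k).trans (iSup_le ha)
  have key : ∀ k : ℕ, (t : ℕ) ≤ k → k ≤ N →
      CondExpIndep (pastσOf a k) (pastσOf b t) (pastσOf a t) P := by
    intro k hk
    induction k, hk using Nat.le_induction with
    | base => intro _ B _; rw [sup_idem]
    | succ k hk ih =>
      intro hkN
      have h1 := ih (by omega)
      have h2 : CondExpIndep (a ⟨k, by omega⟩) (pastσOf b t) (pastσOf a k ⊔ pastσOf a t) P := by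
        rw [sup_eq_left.2 (pastσOf_mono_s7 a hk)]
        exact (H ⟨k, by omega⟩).mono_right (pastσOf_mono_s7 b hk)
      exact (h1.contract h2).mono_left (sup_le (ha _) (hple k)) (hple t)
        (pastσOf_succ_le a ⟨k, by omega⟩)
  exact (key N t.2.le le_rfl).mono_left (hple N) (hple t) (iSup_le_pastσOf a)

theorem CausalOn.shadow {a a' b b' : Fin N → MeasurableSpace Ω}
    (ha : ∀ t, a t ≤ mΩ) (ha' : ∀ t, a' t ≤ mΩ) (hb : ∀ t, b t ≤ mΩ) (hb' : ∀ t, b' t ≤ mΩ)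
    (hab : CausalOn P a b) (ha'a : CausalOn P a' a) (hbb' : CausalOn P b b')
    (h1 : CondExpIndep ((⨆ s, a' s) ⊔ (⨆ s, a s)) (⨆ s, b' s) (⨆ s, b s) P)
    (h2 : CondExpIndep (⨆ s, a' s) (⨆ s, b s) (⨆ s, a s) P) :
    CausalOn P a' b' := by
  intro t
  have pl : ∀ (m : Fin N → MeasurableSpace Ω), (∀ t, m t ≤ mΩ) → ∀ k, pastσOf m k ≤ mΩ :=
    fun m hm k => (pastσOf_le_iSup m k).trans (iSup_le hm)
  have pa := pl a ha t
  have pa' := pl a' ha' t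
  have pb := pl b hb t
  have pb' := pl b' hb' t
  set F : MeasurableSpace Ω := (⨆ s, a' s) ⊔ (⨆ s, a s) with hF
  have hFle : F ≤ mΩ := sup_le (iSup_le ha') (iSup_le ha)
  have paF : pastσOf a t ≤ F := (pastσOf_le_iSup a t).trans le_sup_right
  have pa'F : pastσOf a' t ≤ F := (pastσOf_le_iSup a' t).trans le_sup_left
  have a'F : a' t ≤ F := (le_iSup a' t).trans le_sup_left
  have s1 : CondExpIndep F (pastσOf b' t) (pastσOf b t) P := by
    refine ((hbb'.condExpIndep_iSup hb t).contract (m₄ := F) ?_).mono_left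
      (sup_le hFle (iSup_le hb)) pb le_sup_left
    rw [sup_eq_left.2 (pastσOf_le_iSup b t)]
    exact h1.mono_right (pastσOf_le_iSup b' t)
  have s2 : CondExpIndep F (pastσOf b t) (pastσOf a t) P := by
    refine (hab.condExpIndep_iSup ha t).contract ?_
    rw [sup_eq_left.2 (pastσOf_le_iSup a t)]
    exact h2.mono_right (pastσOf_le_iSup b t)
  have s3 : CondExpIndep F (pastσOf b' t) (pastσOf a t) P := by
    have u1 := (s1.weak_union hFle pb paF).symm hFle pb' (sup_le pb pa)
    exact (((s2.symm hFle pb pa).contract u1).mono_left (sup_le pb' pb) pa le_sup_left).symm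
      pb' hFle pa
  have s4 : CondExpIndep (pastσOf b' t) (a' t) (pastσOf a t ⊔ pastσOf a' t) P :=
    ((s3.weak_union hFle pa pa'F).symm hFle pb' (sup_le pa pa')).mono_right a'F
  have s5 := ((ha'a t).symm (ha' t) pa pa').contract s4
  exact (s5.mono_left (sup_le pb' pa) pa' le_sup_left).symm pb' (ha' t) pa'

end Causal

section Map

variable {Ω E : Type*} {mΩ : MeasurableSpace Ω} {m m₁ m₂ m₃ mE : MeasurableSpace E}
  {P : Measure Ω} [IsProbabilityMeasure P]

theorem condExp_map_comp (hm : m ≤ mE) {f : Ω → E} (hf : Measurable f)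
    {g : E → ℝ} (hg : Integrable g (P.map f)) :
    (P.map f)[g | m] ∘ f =ᵐ[P] P[g ∘ f | m.comap f] := by
  have := Measure.isProbabilityMeasure_map hf.aemeasurable (μ := P)
  have hle : m.comap f ≤ mΩ := (MeasurableSpace.comap_mono hm).trans hf.comap_le
  refine ae_eq_condExp_of_forall_setIntegral_eq hle (hg.comp_measurable hf)
    (fun s _ _ => (integrable_condExp.comp_measurable hf).integrableOn) ?_ ?_
  · rintro s ⟨t, ht, rfl⟩ -
    have e : ∀ h : E → ℝ, AEStronglyMeasurable h (P.map f) →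
        ∫ x in f ⁻¹' t, (h ∘ f) x ∂P = ∫ x in t, h x ∂(P.map f) := fun h hh =>
      (setIntegral_map (hm _ ht) hh hf.aemeasurable).symm
    rw [e _ integrable_condExp.aestronglyMeasurable, e _ hg.aestronglyMeasurable,
      setIntegral_condExp hm hg ht]
  · exact ((stronglyMeasurable_condExp (m := m)).comp_measurable
      (measurable_iff_comap_le.2 le_rfl)).aestronglyMeasurable

theorem condIndepσ_map (h₁ : m₁ ≤ mE) (h₂ : m₂ ≤ mE)
    (h₃ : m₃ ≤ mE) {f : Ω → E} (hf : Measurable f) :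
    CondIndepσ m₁ m₂ m₃ (P.map f) ↔
      CondIndepσ (m₁.comap f) (m₂.comap f) (m₃.comap f) P := by
  have := Measure.isProbabilityMeasure_map hf.aemeasurable (μ := P)
  have key : ∀ A, MeasurableSet[mE] A →
      (P.map f)[A.indicator (fun _ => (1 : ℝ)) | m₃] ∘ f
        =ᵐ[P] P[(f ⁻¹' A).indicator (fun _ => (1 : ℝ)) | m₃.comap f] := fun A hA =>
    condExp_map_comp h₃ hf (integrable_indicator_one hA)
  have meas : ∀ g : E → ℝ, Measurable ((P.map f)[g | m₃]) := fun g =>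
    (stronglyMeasurable_condExp.mono h₃).measurable
  have main : ∀ A B, MeasurableSet[m₁] A → MeasurableSet[m₂] B →
      (((P.map f)[(A ∩ B).indicator (fun _ => (1 : ℝ)) | m₃]) =ᵐ[P.map f]
        ((P.map f)[A.indicator (fun _ => (1 : ℝ)) | m₃]) *
          ((P.map f)[B.indicator (fun _ => (1 : ℝ)) | m₃]) ↔
      (P[(f ⁻¹' A ∩ f ⁻¹' B).indicator (fun _ => (1 : ℝ)) | m₃.comap f]) =ᵐ[P]
        (P[(f ⁻¹' A).indicator (fun _ => (1 : ℝ)) | m₃.comap f]) *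
          (P[(f ⁻¹' B).indicator (fun _ => (1 : ℝ)) | m₃.comap f])) := by
    intro A B hA hB
    have kAB := key (A ∩ B) ((h₁ _ hA).inter (h₂ _ hB))
    have kA := key A (h₁ _ hA)
    have kB := key B (h₂ _ hB)
    rw [preimage_inter] at kAB
    rw [Filter.EventuallyEq, ae_map_iff hf.aemeasurable
      (measurableSet_eq_fun (meas _) ((meas _).mul (meas _)))]
    constructor
    · intro H
      filter_upwards [H, kAB, kA, kB] with ω h h1 h2 h3
      simp only [Function.comp_apply, Pi.mul_apply] at h h1 h2 h3 ⊢
      rw [← h1, ← h2, ← h3, h]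
    · intro H
      filter_upwards [H, kAB, kA, kB] with ω h h1 h2 h3
      simp only [Function.comp_apply, Pi.mul_apply] at h h1 h2 h3 ⊢
      rw [h1, h2, h3, h]
  constructor
  · rintro H _ _ ⟨A, hA, rfl⟩ ⟨B, hB, rfl⟩
    exact (main A B hA hB).1 (H A B hA hB)
  · intro H A B hA hB
    exact (main A B hA hB).2 (H _ _ ⟨A, hA, rfl⟩ ⟨B, hB, rfl⟩)

end Map

section Glue

theorem exists_glue {Ω A C : Type*} [mΩ : MeasurableSpace Ω] [mA : MeasurableSpace A]
    [mC : MeasurableSpace C] [StandardBorelSpace C] [Nonempty C]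
    (P : Measure Ω) [IsProbabilityMeasure P] {f : Ω → A} (hf : Measurable f)
    (γ : Measure (A × C)) [IsProbabilityMeasure γ] (h : γ.map Prod.fst = P.map f) :
    ∃ Θ : Measure (Ω × C), IsProbabilityMeasure Θ ∧ Θ.map Prod.fst = P ∧
      Θ.map (fun z => (f z.1, z.2)) = γ ∧
      CondExpIndep (mΩ.comap Prod.fst) (mC.comap Prod.snd) (mA.comap fun z : Ω × C => f z.1) Θ := by
  set K := γ.condKernel
  set Θ : Measure (Ω × C) := P ⊗ₘ (K.comap f hf) with hΘ
  have hfst : Θ.map Prod.fst = P := Measure.fst_compProd _ _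
  have hγ : (P.map f) ⊗ₘ K = γ := by
    rw [← h]; exact γ.disintegrate K
  refine ⟨Θ, inferInstance, hfst, ?_, ?_⟩
  · ext s hs
    rw [Measure.map_apply (by fun_prop) hs, ← hγ, Measure.compProd_apply hs,
      hΘ, Measure.compProd_apply ((by fun_prop : Measurable fun z : Ω × C => (f z.1, z.2)) hs),
      lintegral_map (Kernel.measurable_kernel_prodMk_left hs) hf]
    rfl
  · rintro _ ⟨B, hB, rfl⟩
    set k : A → ℝ := fun x => (K x B).toReal with hk
    have hkm : Measurable k := (K.measurable_coe hB).ennreal_toReal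
    set g : Ω × C → ℝ := fun z => k (f z.1) with hg
    have hm₁ : mΩ.comap (Prod.fst : Ω × C → Ω) ≤ Prod.instMeasurableSpace := measurable_fst.comap_le
    have hm₃ : mA.comap (fun z : Ω × C => f z.1) ≤ Prod.instMeasurableSpace :=
      (hf.comp measurable_fst).comap_le
    have hgm : Measurable g := hkm.comp (hf.comp measurable_fst)
    have hk1 : ∀ x, ‖k x‖ ≤ 1 := fun x => by
      rw [Real.norm_of_nonneg ENNReal.toReal_nonneg]
      exact ENNReal.toReal_le_of_le_ofReal zero_le_one (by simpa using prob_le_one)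
    have hgi : Integrable g Θ :=
      Integrable.of_bound hgm.aestronglyMeasurable 1 (ae_of_all _ fun z => hk1 _)
    have hgsm : StronglyMeasurable[mA.comap (fun z : Ω × C => f z.1)] g :=
      (hkm.comp (measurable_iff_comap_le.2 le_rfl)).stronglyMeasurable
    have hBm : MeasurableSet ((Prod.snd : Ω × C → C) ⁻¹' B) := measurable_snd hB
    have hbi : Integrable (((Prod.snd : Ω × C → C) ⁻¹' B).indicator (fun _ => (1 : ℝ))) Θ :=
      integrable_indicator_one hBm
    have main : ∀ S, MeasurableSet S → ∫ z in (Prod.fst : Ω × C → Ω) ⁻¹' S,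
        ((Prod.snd : Ω × C → C) ⁻¹' B).indicator (fun _ => (1 : ℝ)) z ∂Θ =
        ∫ z in (Prod.fst : Ω × C → Ω) ⁻¹' S, g z ∂Θ := by
      intro S hS
      have e1 : ∫ z in (Prod.fst : Ω × C → Ω) ⁻¹' S, g z ∂Θ = ∫ w in S, k (f w) ∂P := by
        have := setIntegral_map (μ := Θ) (g := Prod.fst) (f := fun w => k (f w)) hS
          (hkm.comp hf).aestronglyMeasurable measurable_fst.aemeasurable
        rw [hfst] at this
        exact this.symm
      rw [e1, setIntegral_indicator hBm, setIntegral_const, smul_eq_mul, mul_one,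
        ← Set.prod_eq, measureReal_def, hΘ, Measure.compProd_apply_prod hS hB,
        integral_toReal]
      · rfl
      · exact ((K.measurable_coe hB).comp hf).aemeasurable
      · exact ae_of_all _ fun w => measure_lt_top _ _
    have c1 := ae_eq_condExp_sup hm₁ hm₃ hbi hgi hgsm.aestronglyMeasurable (by
      rintro _ _ ⟨S, hS, rfl⟩ ⟨T, hT, rfl⟩
      exact main (S ∩ f ⁻¹' T) (hS.inter (hf hT)))
    have c2 := ae_eq_condExp_sup (m₁ := ⊥) bot_le hm₃ hbi hgi hgsm.aestronglyMeasurable (by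
      rintro S _ hS ⟨T, hT, rfl⟩
      rcases MeasurableSpace.measurableSet_bot_iff.1 hS with rfl | rfl
      · simp
      · rw [univ_inter]; exact main (f ⁻¹' T) (hf hT))
    rw [bot_sup_eq] at c2
    exact c1.symm.trans c2

theorem exists_double_glue {A A' B B' : Type*} [mA : MeasurableSpace A]
    [mA' : MeasurableSpace A'] [mB : MeasurableSpace B] [mB' : MeasurableSpace B']
    [StandardBorelSpace A'] [Nonempty A'] [StandardBorelSpace B'] [Nonempty B']
    (π : Measure (A × B)) [IsProbabilityMeasure π]
    (γ : Measure (A × A')) [IsProbabilityMeasure γ] (hγ : γ.map Prod.fst = π.map Prod.fst)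
    (η : Measure (B × B')) [IsProbabilityMeasure η] (hη : η.map Prod.fst = π.map Prod.snd) :
    ∃ Θ : Measure ((A × B) × (A' × B')), IsProbabilityMeasure Θ ∧ Θ.map Prod.fst = π ∧
      Θ.map (fun z => (z.1.1, z.2.1)) = γ ∧ Θ.map (fun z => (z.1.2, z.2.2)) = η ∧
      CondExpIndep (mA'.comap (fun z => z.2.1) ⊔ mA.comap (fun z => z.1.1))
        (mB'.comap fun z => z.2.2) (mB.comap fun z => z.1.2) Θ ∧
      CondExpIndep (mA'.comap fun z => z.2.1) (mB.comap fun z => z.1.2)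
        (mA.comap fun z => z.1.1) Θ ∧
      CondExpIndep (mB'.comap (fun z => z.2.2) ⊔ mB.comap (fun z => z.1.2))
        (mA'.comap fun z => z.2.1) (mA.comap fun z => z.1.1) Θ ∧
      CondExpIndep (mB'.comap fun z => z.2.2) (mA.comap fun z => z.1.1)
        (mB.comap fun z => z.1.2) Θ := by
  obtain ⟨Θ₁, hΘ₁, f1, f2, f3⟩ := exists_glue π measurable_fst γ hγ
  obtain ⟨Θ₂, hΘ₂, g1, g2, g3⟩ := exists_glue Θ₁ (f := fun z => z.1.2) (by fun_prop) η (by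
    rw [hη, ← f1, Measure.map_map (by fun_prop) (by fun_prop)]; rfl)
  set e : ((A × B) × A') × B' → (A × B) × (A' × B') := fun w => (w.1.1, (w.1.2, w.2)) with he
  have hem : Measurable e := by fun_prop
  set Θ := Θ₂.map e with hΘ
  have hΘp : IsProbabilityMeasure Θ := Measure.isProbabilityMeasure_map hem.aemeasurable
  set s : (A × B) × (A' × B') → ((A × B) × A') × B' := fun w => ((w.1, w.2.1), w.2.2) with hs
  have hsm : Measurable s := by fun_prop
  have hsΘ : Θ.map s = Θ₂ := by
    rw [hΘ, Measure.map_map hsm hem]; exact Measure.map_id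
  have ma : Measurable fun z : (A × B) × (A' × B') => z.1.1 := by fun_prop
  have mb : Measurable fun z : (A × B) × (A' × B') => z.1.2 := by fun_prop
  have ma' : Measurable fun z : (A × B) × (A' × B') => z.2.1 := by fun_prop
  have mb' : Measurable fun z : (A × B) × (A' × B') => z.2.2 := by fun_prop
  set σa := mA.comap fun z : (A × B) × (A' × B') => z.1.1
  set σb := mB.comap fun z : (A × B) × (A' × B') => z.1.2
  set σa' := mA'.comap fun z : (A × B) × (A' × B') => z.2.1
  set σb' := mB'.comap fun z : (A × B) × (A' × B') => z.2.2
  have la := ma.comap_le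
  have lb := mb.comap_le
  have la' := ma'.comap_le
  have lb' := mb'.comap_le
  have k1 : CondExpIndep (σa ⊔ σb) σa' σa Θ := by
    refine (condExpIndep_iff (sup_le la lb) la' la).2 ?_
    have := (condExpIndep_iff measurable_fst.comap_le measurable_snd.comap_le
      (measurable_fst.comp measurable_fst).comap_le).1 f3
    rw [← g1, ← hsΘ, Measure.map_map (by fun_prop) hsm] at this
    have := (condIndepσ_map measurable_fst.comap_le measurable_snd.comap_le
      (measurable_fst.comp measurable_fst).comap_le
      (f := Prod.fst ∘ s) (measurable_fst.comp hsm)).1 this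
    simp only [MeasurableSpace.comap_comp] at this
    convert this using 1
    · simp only [Prod.instMeasurableSpace, MeasurableSpace.prod, MeasurableSpace.comap_sup,
        MeasurableSpace.comap_comp]
      rfl
    · rfl
    · rfl
  have k2 : CondExpIndep (σa ⊔ σb ⊔ σa') σb' σb Θ := by
    refine (condExpIndep_iff (sup_le (sup_le la lb) la') lb' lb).2 ?_
    have hm : Measurable fun z : ((A × B) × A') × B' => z.1.1.2 := by fun_prop
    have := (condExpIndep_iff measurable_fst.comap_le measurable_snd.comap_le hm.comap_le).1 g3
    rw [← hsΘ] at this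
    have := (condIndepσ_map measurable_fst.comap_le measurable_snd.comap_le
      hm.comap_le (f := s) hsm).1 this
    simp only [MeasurableSpace.comap_comp] at this
    convert this using 1
    · simp only [Prod.instMeasurableSpace, MeasurableSpace.prod, MeasurableSpace.comap_sup,
        MeasurableSpace.comap_comp]
      rfl
    · rfl
    · rfl
  refine ⟨Θ, hΘp, ?_, ?_, ?_, ?_, ?_, ?_, ?_⟩
  · rw [hΘ, Measure.map_map (by fun_prop) hem, ← f1, ← g1,
      Measure.map_map (by fun_prop) (by fun_prop)]
    rfl
  · rw [hΘ, Measure.map_map (by fun_prop) hem, ← f2, ← g1,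
      Measure.map_map (by fun_prop) (by fun_prop)]
    rfl
  · rw [hΘ, Measure.map_map (by fun_prop) hem, ← g2]
    rfl
  · exact k2.mono_left (sup_le (sup_le la lb) la') lb
      (sup_le le_sup_right (le_sup_left.trans le_sup_left))
  · exact (k1.mono_left (sup_le la lb) la le_sup_right).symm lb la' la
  · refine (k1.mono_left (sup_le la lb) la le_sup_right).contract ?_
    exact ((k2.weak_union (sup_le (sup_le la lb) la') lb
      (le_sup_left.trans le_sup_left : σa ≤ σa ⊔ σb ⊔ σa')).mono_left
      (sup_le (sup_le la lb) la') (sup_le lb la) le_sup_right).symm la' lb' (sup_le lb la)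
  · exact (k2.mono_left (sup_le (sup_le la lb) la') lb
      (le_sup_left.trans le_sup_left)).symm la lb' lb

end Glue

theorem isCausalFor_map_iff {Ω A B : Type*} [mΩ : MeasurableSpace Ω] [m₁ : MeasurableSpace A]
    [m₂ : MeasurableSpace B] {P : Measure Ω} [IsProbabilityMeasure P] {f : Ω → A} {g : Ω → B}
    (hf : Measurable f) (hg : Measurable g) {mA : Fin N → MeasurableSpace A}
    {mB : Fin N → MeasurableSpace B} (hA : ∀ t, mA t ≤ m₁) (hB : ∀ t, mB t ≤ m₂) :
    IsCausalFor mA mB (P.map fun ω => (f ω, g ω)) ↔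
      CausalOn P (fun t => (mA t).comap f) (fun t => (mB t).comap g) := by
  have hpA : ∀ t, pastσOf mA t ≤ m₁ := fun t => (pastσOf_le_iSup mA t).trans (iSup_le hA)
  have hpB : ∀ t, pastσOf mB t ≤ m₂ := fun t => (pastσOf_le_iSup mB t).trans (iSup_le hB)
  have cf : ∀ {m : MeasurableSpace A}, m ≤ m₁ → m.comap f ≤ mΩ := fun h =>
    (MeasurableSpace.comap_mono h).trans hf.comap_le
  have cg : ∀ {m : MeasurableSpace B}, m ≤ m₂ → m.comap g ≤ mΩ := fun h =>
    (MeasurableSpace.comap_mono h).trans hg.comap_le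
  have df : ∀ {m : MeasurableSpace A}, m ≤ m₁ →
      m.comap (Prod.fst : A × B → A) ≤ @Prod.instMeasurableSpace A B m₁ m₂ := fun h =>
    (MeasurableSpace.comap_mono h).trans (@measurable_fst A B m₁ m₂).comap_le
  have dg : ∀ {m : MeasurableSpace B}, m ≤ m₂ →
      m.comap (Prod.snd : A × B → B) ≤ @Prod.instMeasurableSpace A B m₁ m₂ := fun h =>
    (MeasurableSpace.comap_mono h).trans (@measurable_snd A B m₁ m₂).comap_le
  refine forall_congr' fun t => ?_
  rw [condIndepσ_map (df (hA t)) (dg (hpB t)) (df (hpA t)) (hf.prodMk hg),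
    MeasurableSpace.comap_comp, MeasurableSpace.comap_comp, MeasurableSpace.comap_comp,
    ← pastσOf_comap, ← pastσOf_comap, condExpIndep_iff (cf (hA t)) (cg (hpB t)) (cf (hpA t))]
  rfl

theorem condExpIndep_of_indep {Ω : Type*} {m₁ m₂ m₃ mΩ : MeasurableSpace Ω} {P : Measure Ω}
    [IsProbabilityMeasure P] (h₁ : m₁ ≤ mΩ) (h₂ : m₂ ≤ mΩ) (h₃ : m₃ ≤ mΩ)
    (H : Indep (m₁ ⊔ m₃) m₂ P) : CondExpIndep m₁ m₂ m₃ P := by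
  intro B hB
  have hsm : StronglyMeasurable[m₂] (B.indicator fun _ => (1 : ℝ)) :=
    StronglyMeasurable.indicator (@stronglyMeasurable_const _ _ m₂ _ _) hB
  exact (condExp_indep_eq h₂ (sup_le h₁ h₃) hsm H.symm).trans (condExp_indep_eq h₂ h₃ hsm
    (indep_of_indep_of_le_left H le_sup_right).symm).symm

section PathSpace

variable {X Y : Fin N → Type*} [∀ t, MeasurableSpace (X t)] [∀ t, MeasurableSpace (Y t)]

theorem coordσ_le (t : Fin N) : coordσ X t ≤ MeasurableSpace.pi :=
  (measurable_pi_apply t).comap_le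

theorem isCausal_map_iff {Ω : Type*} [MeasurableSpace Ω] {P : Measure Ω}
    [IsProbabilityMeasure P] {f : Ω → ∀ t, X t} {g : Ω → ∀ t, Y t} (hf : Measurable f)
    (hg : Measurable g) :
    IsCausal (P.map fun ω => (f ω, g ω)) ↔
      CausalOn P (fun t => (coordσ X t).comap f) (fun t => (coordσ Y t).comap g) :=
  isCausalFor_map_iff hf hg coordσ_le coordσ_le

theorem isAnticausal_iff_isCausal_map_swap {π : Measure ((∀ t, X t) × (∀ t, Y t))} :
    IsAnticausal π ↔ IsCausal (π.map Prod.swap) := Iff.rfl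

theorem isAnticausal_map_iff {Ω : Type*} [MeasurableSpace Ω] {P : Measure Ω}
    [IsProbabilityMeasure P] {f : Ω → ∀ t, X t} {g : Ω → ∀ t, Y t} (hf : Measurable f)
    (hg : Measurable g) :
    IsAnticausal (P.map fun ω => (f ω, g ω)) ↔
      CausalOn P (fun t => (coordσ Y t).comap g) (fun t => (coordσ X t).comap f) := by
  rw [isAnticausal_iff_isCausal_map_swap, Measure.map_map measurable_swap (hf.prodMk hg),
    ← isCausal_map_iff hg hf]
  rfl

theorem IsCoupling.isProbabilityMeasure {A B : Type*} [MeasurableSpace A] [MeasurableSpace B]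
    {μ : Measure A} {ν : Measure B} [IsProbabilityMeasure μ] {π : Measure (A × B)}
    (h : IsCoupling μ ν π) : IsProbabilityMeasure π := by
  refine ⟨?_⟩
  rw [← preimage_univ (f := Prod.fst), ← Measure.map_apply measurable_fst .univ, h.1]
  exact measure_univ

theorem IsCoupling.swap {A B : Type*} [MeasurableSpace A] [MeasurableSpace B]
    {μ : Measure A} {ν : Measure B} {π : Measure (A × B)}
    (h : IsCoupling μ ν π) : IsCoupling ν μ (π.map Prod.swap) := by
  constructor
  · rw [Measure.map_map measurable_fst measurable_swap]; exact h.2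
  · rw [Measure.map_map measurable_snd measurable_swap]; exact h.1

theorem swap_mem_aCouplings_bicausal {μ : Measure (∀ t, X t)} {ν : Measure (∀ t, Y t)}
    {π : Measure ((∀ t, X t) × (∀ t, Y t))} (h : π ∈ aCouplings .bicausal μ ν) :
    π.map Prod.swap ∈ aCouplings .bicausal ν μ := by
  refine ⟨h.1.swap, h.2.2, ?_⟩
  rw [isAnticausal_iff_isCausal_map_swap, Measure.map_map measurable_swap measurable_swap,
    Prod.swap_swap_eq, Measure.map_id]
  exact h.2.1

theorem isAdapted_of_isBicausal {b : Flavor} {π : Measure ((∀ t, X t) × (∀ t, Y t))}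
    (h : IsBicausal π) : IsAdapted b π := by
  cases b
  exacts [trivial, h.1, h.2, h]

theorem isAdapted_congr {X' Y' : Fin N → Type*} [∀ t, MeasurableSpace (X' t)]
    [∀ t, MeasurableSpace (Y' t)] {π : Measure ((∀ t, X t) × (∀ t, Y t))}
    {π' : Measure ((∀ t, X' t) × (∀ t, Y' t))} (hc : IsCausal π → IsCausal π')
    (ha : IsAnticausal π → IsAnticausal π') {b : Flavor} (h : IsAdapted b π) :
    IsAdapted b π' := by
  cases b
  exacts [trivial, hc h, ha h, ⟨hc h.1, ha h.2⟩]

theorem isCausal_prod {μ : Measure (∀ t, X t)} {ν : Measure (∀ t, Y t)}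
    [IsProbabilityMeasure μ] [IsProbabilityMeasure ν] : IsCausal (μ.prod ν) := by
  have hX : ∀ t, pastσ X t ≤ MeasurableSpace.pi := fun t =>
    (pastσOf_le_iSup _ t).trans (iSup_le coordσ_le)
  have hY : ∀ t, pastσ Y t ≤ MeasurableSpace.pi := fun t =>
    (pastσOf_le_iSup _ t).trans (iSup_le coordσ_le)
  intro t
  refine (condExpIndep_iff ?_ ?_ ?_).1 ?_
  · exact (MeasurableSpace.comap_mono (coordσ_le t)).trans measurable_fst.comap_le
  · exact (MeasurableSpace.comap_mono (hY t)).trans measurable_snd.comap_le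
  · exact (MeasurableSpace.comap_mono (hX t)).trans measurable_fst.comap_le
  refine condExpIndep_of_indep ?_ ?_ ?_ ?_
  · exact (MeasurableSpace.comap_mono (coordσ_le t)).trans measurable_fst.comap_le
  · exact (MeasurableSpace.comap_mono (hY t)).trans measurable_snd.comap_le
  · exact (MeasurableSpace.comap_mono (hX t)).trans measurable_fst.comap_le
  rw [← MeasurableSpace.comap_sup]
  have hi : IndepFun (Prod.fst : (∀ t, X t) × (∀ t, Y t) → _) Prod.snd (μ.prod ν) :=
    indepFun_prod measurable_id measurable_id
  exact indep_of_indep_of_le_left (indep_of_indep_of_le_right hi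
    (MeasurableSpace.comap_mono (hY t))) (MeasurableSpace.comap_mono (sup_le (coordσ_le t) (hX t)))

theorem prod_mem_aCouplings (b : Flavor) (μ : Measure (∀ t, X t)) (ν : Measure (∀ t, Y t))
    [IsProbabilityMeasure μ] [IsProbabilityMeasure ν] : μ.prod ν ∈ aCouplings b μ ν := by
  refine ⟨⟨?_, ?_⟩, isAdapted_of_isBicausal ⟨isCausal_prod, ?_⟩⟩
  · exact Measure.fst_prod
  · exact Measure.snd_prod
  · rw [isAnticausal_iff_isCausal_map_swap, Measure.prod_swap]
    exact isCausal_prod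

theorem iSup_coordσ_comap {Ω : Type*} (f : Ω → ∀ t, X t) :
    ⨆ t, (coordσ X t).comap f = MeasurableSpace.pi.comap f := by
  rw [← MeasurableSpace.comap_iSup]
  rfl

/-- Transporting the marginals of a coupling along bicausal couplings preserves adaptedness. -/
theorem exists_shadow [∀ t, StandardBorelSpace (X t)] [∀ t, StandardBorelSpace (Y t)]
    (b : Flavor) {μ μ' : Measure (∀ t, X t)} {ν ν' : Measure (∀ t, Y t)}
    [IsProbabilityMeasure μ] [IsProbabilityMeasure ν]
    {γ : Measure ((∀ t, X t) × (∀ t, X t))} {η : Measure ((∀ t, Y t) × (∀ t, Y t))}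
    {π : Measure ((∀ t, X t) × (∀ t, Y t))} (hγ : γ ∈ aCouplings .bicausal μ μ')
    (hη : η ∈ aCouplings .bicausal ν ν') (hπ : π ∈ aCouplings b μ ν) :
    ∃ Θ : Measure (((∀ t, X t) × (∀ t, Y t)) × ((∀ t, X t) × (∀ t, Y t))),
      IsProbabilityMeasure Θ ∧ Θ.map Prod.fst = π ∧ Θ.map Prod.snd ∈ aCouplings b μ' ν' ∧
      Θ.map (fun z => (z.1.1, z.2.1)) = γ ∧ Θ.map (fun z => (z.1.2, z.2.2)) = η := by
  have := hγ.1.isProbabilityMeasure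
  have := hη.1.isProbabilityMeasure
  have := hπ.1.isProbabilityMeasure
  have : Nonempty (∀ t, X t) := nonempty_of_isProbabilityMeasure μ
  have : Nonempty (∀ t, Y t) := nonempty_of_isProbabilityMeasure ν
  obtain ⟨Θ, hΘ, h1, h2, h3, i1, i2, i3, i4⟩ := exists_double_glue π γ
    (hγ.1.1.trans hπ.1.1.symm) η (hη.1.1.trans hπ.1.2.symm)
  have ma : Measurable fun z : ((∀ t, X t) × (∀ t, Y t)) × ((∀ t, X t) × (∀ t, Y t)) =>
    z.1.1 := by fun_prop
  have mb : Measurable fun z : ((∀ t, X t) × (∀ t, Y t)) × ((∀ t, X t) × (∀ t, Y t)) =>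
    z.1.2 := by fun_prop
  have ma' : Measurable fun z : ((∀ t, X t) × (∀ t, Y t)) × ((∀ t, X t) × (∀ t, Y t)) =>
    z.2.1 := by fun_prop
  have mb' : Measurable fun z : ((∀ t, X t) × (∀ t, Y t)) × ((∀ t, X t) × (∀ t, Y t)) =>
    z.2.2 := by fun_prop
  have lX : ∀ {f : ((∀ t, X t) × (∀ t, Y t)) × ((∀ t, X t) × (∀ t, Y t)) → ∀ t, X t},
      Measurable f → ∀ t, (coordσ X t).comap f ≤ Prod.instMeasurableSpace := fun hf t =>
    (MeasurableSpace.comap_mono (coordσ_le t)).trans hf.comap_le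
  have lY : ∀ {f : ((∀ t, X t) × (∀ t, Y t)) × ((∀ t, X t) × (∀ t, Y t)) → ∀ t, Y t},
      Measurable f → ∀ t, (coordσ Y t).comap f ≤ Prod.instMeasurableSpace := fun hf t =>
    (MeasurableSpace.comap_mono (coordσ_le t)).trans hf.comap_le
  have g1 := hγ.2.1
  have g2 := hγ.2.2
  have e1 := hη.2.1
  have e2 := hη.2.2
  rw [← h2, isCausal_map_iff ma ma'] at g1
  rw [← h2, isAnticausal_map_iff ma ma'] at g2
  rw [← h3, isCausal_map_iff mb mb'] at e1
  rw [← h3, isAnticausal_map_iff mb mb'] at e2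
  refine ⟨Θ, hΘ, h1, ⟨⟨?_, ?_⟩, isAdapted_congr ?_ ?_ hπ.2⟩, h2, h3⟩
  · rw [Measure.map_map measurable_fst measurable_snd, ← hγ.1.2, ← h2,
      Measure.map_map measurable_snd (ma.prodMk ma')]
    rfl
  · rw [Measure.map_map measurable_snd measurable_snd, ← hη.1.2, ← h3,
      Measure.map_map measurable_snd (mb.prodMk mb')]
    rfl
  · intro h
    rw [← h1] at h
    refine (isCausal_map_iff ma' mb').2 (CausalOn.shadow (lX ma) (lX ma') (lY mb) (lY mb')
      ((isCausal_map_iff ma mb).1 h) g2 e1 ?_ ?_)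
    · simpa only [iSup_coordσ_comap] using i1
    · simpa only [iSup_coordσ_comap] using i2
  · intro h
    rw [← h1] at h
    refine (isAnticausal_map_iff ma' mb').2 (CausalOn.shadow (lY mb) (lY mb') (lX ma) (lX ma')
      ((isAnticausal_map_iff ma mb).1 h) e2 g1 ?_ ?_)
    · simpa only [iSup_coordσ_comap] using i3
    · simpa only [iSup_coordσ_comap] using i4

end PathSpace

theorem exists_lcost_lt_of_tendsto_W {X : Fin N → Type*} [∀ t, MeasurableSpace (X t)]
    [∀ t, PseudoEMetricSpace (X t)] {p : ℝ} (hp : 0 < p) {b : Flavor}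
    {μs : ℕ → Measure (∀ t, X t)} {μ : Measure (∀ t, X t)}
    (h : Tendsto (fun n => W p b (μs n) μ) atTop (𝓝 0)) {ε : ℝ≥0∞} (hε : 0 < ε) :
    ∀ᶠ n in atTop, ∃ γ ∈ aCouplings b (μs n) μ, lcost p γ < ε := by
  have hp' : 0 < 1 / p := by positivity
  have h0 : 0 < ε ^ (1 / p) := by
    have := ENNReal.rpow_lt_rpow hε hp'
    rwa [ENNReal.zero_rpow_of_pos hp'] at this
  filter_upwards [h.eventually_lt_const h0] with n hn
  rw [W, ENNReal.rpow_lt_rpow_iff hp', iInf_lt_iff] at hn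
  obtain ⟨γ, hγ⟩ := hn
  exact ⟨γ.1, γ.2, hγ⟩

theorem lcost_map_swap (p : ℝ) {A : Type*} [MeasurableSpace A] [PseudoEMetricSpace A]
    (π : Measure (A × A)) : lcost p (π.map Prod.swap) = lcost p π := by
  change ∫⁻ z, _ ∂(π.map (MeasurableEquiv.prodComm : A × A ≃ᵐ A × A)) = _
  rw [lintegral_map_equiv]
  exact lintegral_congr fun z => by rw [edist_comm]; rfl

theorem edist_rpow_sub_le {A : Type*} [PseudoEMetricSpace A] {p : ℝ} (hp : 1 ≤ p)
    (x₀ x x' : A) (r : ℝ≥0) :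
    edist x₀ x' ^ p - ((2 : ℝ≥0) ^ (p - 1) * r : ℝ≥0) ≤
      (2 : ℝ≥0∞) ^ (p - 1) * ((edist x₀ x ^ p - r) + edist x x' ^ p) := by
  have h2 : (((2 : ℝ≥0) ^ (p - 1) : ℝ≥0) : ℝ≥0∞) = 2 ^ (p - 1) := by
    rw [ENNReal.coe_rpow_of_nonneg _ (by linarith)]; rfl
  rw [ENNReal.coe_mul, h2, tsub_le_iff_right, ← mul_add]
  calc edist x₀ x' ^ p ≤ (edist x₀ x + edist x x') ^ p :=
        ENNReal.rpow_le_rpow (edist_triangle _ _ _) (by linarith)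
    _ ≤ 2 ^ (p - 1) * (edist x₀ x ^ p + edist x x' ^ p) :=
        ENNReal.rpow_add_le_mul_rpow_add_rpow _ _ hp
    _ ≤ _ := by
        refine mul_le_mul' le_rfl ?_
        rw [add_right_comm]
        gcongr
        exact le_tsub_add

theorem exists_boundedContinuous_edist_le {A B : Type*} [MetricSpace A] [MetricSpace B]
    {p : ℝ} (hp : 0 ≤ p) {c : A × B → ℝ}
    (hc : Continuous c) (hcg : GrowthLE p c) :
    ∃ (x₀ : A) (y₀ : B) (M : ℝ≥0), ∀ r : ℝ≥0, ∃ f : BoundedContinuousFunction (A × B) ℝ,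
      ∀ z, ‖c z - f z‖ₑ ≤ M * ((edist x₀ z.1 ^ p - r) + (edist y₀ z.2 ^ p - r)) := by
  obtain ⟨x₀, y₀, M, hM⟩ := hcg
  refine ⟨x₀, y₀, Real.toNNReal M, fun r => ?_⟩
  set L : ℝ := ((Real.toNNReal M : ℝ≥0) : ℝ) with hL
  set R : ℝ := L * (1 + 2 * r) with hR
  have hR0 : 0 ≤ R := by positivity
  refine ⟨BoundedContinuousFunction.ofNormedAddCommGroup (fun z => max (-R) (min R (c z)))
    (by fun_prop) R (fun z => ?_), fun z => ?_⟩
  · rw [Real.norm_eq_abs, abs_le]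
    exact ⟨le_max_left _ _, max_le (by linarith) (min_le_left _ _)⟩
  · have e1 : edist x₀ z.1 ^ p = ENNReal.ofReal (dist x₀ z.1 ^ p) := by
      rw [edist_dist, ENNReal.ofReal_rpow_of_nonneg dist_nonneg hp]
    have e2 : edist y₀ z.2 ^ p = ENNReal.ofReal (dist y₀ z.2 ^ p) := by
      rw [edist_dist, ENNReal.ofReal_rpow_of_nonneg dist_nonneg hp]
    have hz := hM z
    simp only [edist_dist, ENNReal.toReal_ofReal dist_nonneg] at hz
    set a := dist x₀ z.1 ^ p with ha
    set b := dist y₀ z.2 ^ p with hb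
    have ha0 : 0 ≤ a := by positivity
    have hb0 : 0 ≤ b := by positivity
    have hML : M ≤ L := Real.le_coe_toNNReal M
    have hz' : |c z| ≤ L * (1 + a + b) :=
      hz.trans (mul_le_mul_of_nonneg_right hML (by positivity))
    have hmax : ∀ x : ℝ, ENNReal.ofReal (max x 0) = ENNReal.ofReal x := fun x => by
      rcases le_total x 0 with h | h
      · rw [max_eq_right h, ENNReal.ofReal_zero, ENNReal.ofReal_of_nonpos h]
      · rw [max_eq_left h]
    rw [e1, e2, ← ENNReal.ofReal_coe_nnreal (p := r), ← ENNReal.ofReal_sub _ r.coe_nonneg,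
      ← ENNReal.ofReal_sub _ r.coe_nonneg, ← hmax (a - r), ← hmax (b - r),
      ← ENNReal.ofReal_add (le_max_right _ _) (le_max_right _ _),
      ← ENNReal.ofReal_coe_nnreal (p := Real.toNNReal M), ← ENNReal.ofReal_mul (by positivity),
      Real.enorm_eq_ofReal_abs]
    refine ENNReal.ofReal_le_ofReal ?_
    change |c z - max (-R) (min R (c z))| ≤ L * _
    have k1 : |c z| - R ≤ L * (max (a - r) 0 + max (b - r) 0) := by
      have : L * (1 + a + b) - R = L * ((a - r) + (b - r)) := by rw [hR]; ring
      calc |c z| - R ≤ L * ((a - r) + (b - r)) := by linarith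
        _ ≤ _ := by gcongr <;> exact le_max_left _ _
    have k2 : 0 ≤ L * (max (a - r) 0 + max (b - r) 0) := by positivity
    rw [abs_le]
    have := abs_le.1 (le_refl |c z|)
    constructor <;> rcases max_cases (-R) (min R (c z)) with h | h <;>
      rcases min_cases R (c z) with h' | h' <;> linarith

section Analysis

variable {A B : Type*} [MeasurableSpace A] [MetricSpace A] [MeasurableSpace B] [MetricSpace B]

theorem exists_lintegral_edist_sub_le [OpensMeasurableSpace A] {p : ℝ} {μ : Measure A}
    [IsProbabilityMeasure μ] (hμ : MemPp p μ) (x₀ : A) {ε : ℝ≥0∞} (hε : 0 < ε) :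
    ∃ r₀ : ℝ≥0, ∀ r, r₀ ≤ r → ∫⁻ x, (edist x₀ x ^ p - r) ∂μ ≤ ε := by
  have h : Tendsto (fun r : ℝ≥0 => ∫⁻ x, (edist x₀ x ^ p - r) ∂μ) atTop
      (𝓝 (∫⁻ _, 0 ∂μ)) := by
    refine tendsto_lintegral_filter_of_dominated_convergence (fun x => edist x₀ x ^ p)
      (Eventually.of_forall fun r => by fun_prop)
      (Eventually.of_forall fun r => ae_of_all _ fun x => tsub_le_self) (hμ x₀) ?_
    have hfin := ae_lt_top (by fun_prop) (hμ x₀)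
    filter_upwards [hfin] with x hx
    lift edist x₀ x ^ p to ℝ≥0 using hx.ne with a
    refine tendsto_const_nhds.congr' ?_
    filter_upwards [eventually_ge_atTop a] with r hr
    exact (tsub_eq_zero_of_le (by exact_mod_cast hr)).symm
  rw [lintegral_zero] at h
  exact eventually_atTop.1 (h.eventually_le_const hε)

theorem lintegral_edist_sub_snd_le [OpensMeasurableSpace A] [SecondCountableTopology A]
    {p : ℝ} (hp : 1 ≤ p) (γ : Measure (A × A)) (x₀ : A) (r : ℝ≥0) :
    ∫⁻ x, (edist x₀ x ^ p - ((2 : ℝ≥0) ^ (p - 1) * r : ℝ≥0)) ∂(γ.map Prod.snd) ≤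
      (2 : ℝ≥0∞) ^ (p - 1) * (∫⁻ x, (edist x₀ x ^ p - r) ∂(γ.map Prod.fst) + lcost p γ) := by
  rw [lintegral_map (by fun_prop) measurable_snd, lintegral_map (by fun_prop) measurable_fst,
    lcost, ← lintegral_add_left (by fun_prop), ← lintegral_const_mul _ (by fun_prop)]
  exact lintegral_mono fun z => edist_rpow_sub_le hp x₀ z.1 z.2 r

theorem abs_integral_sub_le {Ω : Type*} [MeasurableSpace Ω] {P : Measure Ω} {f g : Ω → ℝ}
    (hf : Integrable f P) (hg : Integrable g P) {ε : ℝ} (hε : 0 ≤ ε)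
    (h : ∫⁻ ω, ‖f ω - g ω‖ₑ ∂P ≤ ENNReal.ofReal ε) :
    |∫ ω, f ω ∂P - ∫ ω, g ω ∂P| ≤ ε := by
  rw [← integral_sub hf hg, ← Real.norm_eq_abs]
  have := (enorm_integral_le_lintegral_enorm _).trans h
  rwa [← ofReal_norm, ENNReal.ofReal_le_ofReal_iff hε] at this

end Analysis

theorem exists_isCompact_measure_compl_le {A : Type*} [MeasurableSpace A] [TopologicalSpace A]
    [PolishSpace A] [BorelSpace A] (μ : Measure A) [IsProbabilityMeasure μ] {ε : ℝ≥0∞}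
    (hε : 0 < ε) : ∃ K : Set A, IsCompact K ∧ μ Kᶜ ≤ ε := by
  let := TopologicalSpace.upgradeIsCompletelyMetrizable A
  obtain ⟨K, hK, h⟩ := isTightMeasureSet_iff_exists_isCompact_measure_compl_le.1
    (isTightMeasureSet_singleton (μ := μ)) ε hε
  exact ⟨K, hK, h μ rfl⟩

theorem lintegral_enorm_sub_le {A B : Type*} [MeasurableSpace A] [MetricSpace A]
    [OpensMeasurableSpace A] [MeasurableSpace B] [MetricSpace B] [OpensMeasurableSpace B]
    {p : ℝ} {c f : A × B → ℝ} {x₀ : A} {y₀ : B} {M r : ℝ≥0}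
    (hf : ∀ z, ‖c z - f z‖ₑ ≤ M * ((edist x₀ z.1 ^ p - r) + (edist y₀ z.2 ^ p - r)))
    {μ : Measure A} {ν : Measure B} {π : Measure (A × B)} (hπ : IsCoupling μ ν π) :
    ∫⁻ z, ‖c z - f z‖ₑ ∂π ≤
      M * (∫⁻ x, (edist x₀ x ^ p - r) ∂μ + ∫⁻ y, (edist y₀ y ^ p - r) ∂ν) := by
  rw [← hπ.1, ← hπ.2, lintegral_map (by fun_prop) measurable_fst,
    lintegral_map (by fun_prop) measurable_snd, ← lintegral_add_left (by fun_prop),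
    ← lintegral_const_mul _ (by fun_prop)]
  exact lintegral_mono hf

theorem GrowthLE.integrable {A B : Type*} [MeasurableSpace A] [MetricSpace A] [BorelSpace A]
    [MeasurableSpace B] [MetricSpace B] [PolishSpace B] [BorelSpace B] {p : ℝ}
    (hp : 0 ≤ p) {c : A × B → ℝ} (hc : Continuous c) (hcg : GrowthLE p c) {μ : Measure A}
    {ν : Measure B} [IsProbabilityMeasure μ] (hμ : MemPp p μ) (hν : MemPp p ν)
    {π : Measure (A × B)} (hπ : IsCoupling μ ν π) : Integrable c π := by
  have := hπ.isProbabilityMeasure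
  obtain ⟨x₀, y₀, M, h⟩ := exists_boundedContinuous_edist_le hp hc hcg
  obtain ⟨f, hf⟩ := h 0
  have hfi : Integrable f π := f.integrable π
  have hd : Integrable (fun z => c z - f z) π := by
    refine ⟨(hc.sub f.continuous).aestronglyMeasurable, ?_⟩
    refine (lintegral_enorm_sub_le hf hπ).trans_lt (ENNReal.mul_lt_top ENNReal.coe_lt_top ?_)
    simp only [ENNReal.coe_zero, tsub_zero]
    exact ENNReal.add_lt_top.2 ⟨(hμ x₀).lt_top, (hν y₀).lt_top⟩
  exact (hd.add hfi).congr (ae_of_all _ fun z => by simp)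

section Estimate

variable {A B : Type*} [MeasurableSpace A] [MetricSpace A] [PolishSpace A] [BorelSpace A]
  [MeasurableSpace B] [MetricSpace B] [PolishSpace B] [BorelSpace B]

theorem measure_le_edist_le {p : ℝ} (hp : 0 < p) (γ : Measure (A × A)) {r : ℝ} (hr : 0 < r) :
    γ {z | ENNReal.ofReal r ≤ edist z.1 z.2} ≤ lcost p γ / ENNReal.ofReal r ^ p := by
  have h := meas_ge_le_lintegral_div (μ := γ) (f := fun z => edist z.1 z.2 ^ p)
    (by fun_prop) (ε := ENNReal.ofReal r ^ p)
    (by simp [ENNReal.rpow_eq_zero_iff, hr, hp])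
    (ENNReal.rpow_ne_top_of_nonneg hp.le ENNReal.ofReal_ne_top)
  simp only [ENNReal.rpow_le_rpow_iff hp] at h
  exact h

/-- Integrals of a bounded continuous function against the two marginals of a transport plan
are close as soon as the transport cost is small, uniformly over plans whose first marginal is a
coupling of two given measures. -/
theorem exists_forall_abs_integral_boundedContinuous_sub_le {p : ℝ} (hp : 0 < p)
    (μ : Measure A) (ν : Measure B) [IsProbabilityMeasure μ] [IsProbabilityMeasure ν]
    (f : BoundedContinuousFunction (A × B) ℝ) {ε : ℝ} (hε : 0 < ε) :
    ∃ δ : ℝ≥0∞, 0 < δ ∧ ∀ Θ : Measure ((A × B) × (A × B)), IsProbabilityMeasure Θ →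
      IsCoupling μ ν (Θ.map Prod.fst) →
      lcost p (Θ.map fun z => (z.1.1, z.2.1)) ≤ δ → lcost p (Θ.map fun z => (z.1.2, z.2.2)) ≤ δ →
      |∫ z, f z ∂(Θ.map Prod.fst) - ∫ z, f z ∂(Θ.map Prod.snd)| ≤ ε := by
  set M : ℝ := ‖f‖ with hM
  have hM0 : 0 ≤ M := norm_nonneg f
  set t : ℝ := ε / (2 + 8 * M) with ht
  have ht0 : 0 < t := by positivity
  have hτ : 0 < ENNReal.ofReal t := ENNReal.ofReal_pos.2 ht0
  obtain ⟨K, hK, hKμ⟩ := exists_isCompact_measure_compl_le μ hτ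
  obtain ⟨L, hL, hLν⟩ := exists_isCompact_measure_compl_le ν hτ
  have hunif := (hK.prod hL).uniformContinuousAt_of_continuousAt f
    (fun a _ => f.continuous.continuousAt) (Metric.dist_mem_uniformity ht0)
  obtain ⟨r, hr, hunif⟩ := Metric.mem_uniformity_dist.1 hunif
  have hrp0 : ENNReal.ofReal r ^ p ≠ 0 := by simp [ENNReal.rpow_eq_zero_iff, hr, hp]
  have hrpt : ENNReal.ofReal r ^ p ≠ ⊤ :=
    ENNReal.rpow_ne_top_of_nonneg hp.le ENNReal.ofReal_ne_top
  refine ⟨ENNReal.ofReal t * ENNReal.ofReal r ^ p, ENNReal.mul_pos hτ.ne' hrp0, ?_⟩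
  intro Θ hΘ hc h1 h2
  have mX : Measurable fun z : (A × B) × (A × B) => (z.1.1, z.2.1) := by fun_prop
  have mY : Measurable fun z : (A × B) × (A × B) => (z.1.2, z.2.2) := by fun_prop
  have b1 : Θ {z | ENNReal.ofReal r ≤ edist z.1.1 z.2.1} ≤ ENNReal.ofReal t := by
    have := (measure_le_edist_le hp _ hr).trans (ENNReal.div_le_of_le_mul h1)
    rwa [Measure.map_apply mX (measurableSet_le measurable_const (by fun_prop))] at this
  have b2 : Θ {z | ENNReal.ofReal r ≤ edist z.1.2 z.2.2} ≤ ENNReal.ofReal t := by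
    have := (measure_le_edist_le hp _ hr).trans (ENNReal.div_le_of_le_mul h2)
    rwa [Measure.map_apply mY (measurableSet_le measurable_const (by fun_prop))] at this
  have b3 : Θ {z | z.1.1 ∉ K} ≤ ENNReal.ofReal t := by
    rw [← hc.1, Measure.map_map measurable_fst measurable_fst,
      Measure.map_apply (measurable_fst.comp measurable_fst) hK.measurableSet.compl] at hKμ
    exact hKμ
  have b4 : Θ {z | z.1.2 ∉ L} ≤ ENNReal.ofReal t := by
    rw [← hc.2, Measure.map_map measurable_snd measurable_fst,
      Measure.map_apply (measurable_snd.comp measurable_fst) hL.measurableSet.compl] at hLν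
    exact hLν
  set S : Set ((A × B) × (A × B)) := ({z | z.1.1 ∉ K} ∪ {z | z.1.2 ∉ L}) ∪
    ({z | ENNReal.ofReal r ≤ edist z.1.1 z.2.1} ∪ {z | ENNReal.ofReal r ≤ edist z.1.2 z.2.2})
    with hSdef
  have hSm : MeasurableSet S :=
    (((measurable_fst.comp measurable_fst) hK.measurableSet.compl).union
      ((measurable_snd.comp measurable_fst) hL.measurableSet.compl)).union
      ((measurableSet_le measurable_const (by fun_prop)).union
        (measurableSet_le measurable_const (by fun_prop)))
  have hSle : Θ S ≤ ENNReal.ofReal (4 * t) := by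
    calc Θ S ≤ (ENNReal.ofReal t + ENNReal.ofReal t) + (ENNReal.ofReal t + ENNReal.ofReal t) :=
          (measure_union_le _ _).trans (add_le_add ((measure_union_le _ _).trans
            (add_le_add b3 b4)) ((measure_union_le _ _).trans (add_le_add b1 b2)))
      _ = ENNReal.ofReal (4 * t) := by
          rw [← ENNReal.ofReal_add ht0.le ht0.le, ← ENNReal.ofReal_add (by positivity)
            (by positivity)]
          congr 1; ring
  have hfi : ∀ g : (A × B) × (A × B) → A × B, Measurable g → Integrable (fun z => f (g z)) Θ :=
    fun g hg => Integrable.of_bound (f.continuous.measurable.comp hg).aestronglyMeasurable ‖f‖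
      (ae_of_all _ fun z => f.norm_coe_le_norm _)
  rw [integral_map measurable_fst.aemeasurable f.continuous.measurable.aestronglyMeasurable,
    integral_map measurable_snd.aemeasurable f.continuous.measurable.aestronglyMeasurable]
  refine abs_integral_sub_le (hfi _ measurable_fst) (hfi _ measurable_snd) hε.le ?_
  have hpt : ∀ z, ‖f z.1 - f z.2‖ₑ ≤ ENNReal.ofReal t +
      S.indicator (fun _ => ENNReal.ofReal (2 * M)) z := by
    intro z
    rw [← ofReal_norm]
    by_cases hz : z ∈ S
    · rw [indicator_of_mem hz]
      refine le_add_left (ENNReal.ofReal_le_ofReal ?_)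
      have := norm_sub_le (f z.1) (f z.2)
      linarith [f.norm_coe_le_norm z.1, f.norm_coe_le_norm z.2]
    · rw [indicator_of_notMem hz, add_zero]
      simp only [hSdef, mem_union, mem_ofPred_eq, not_or, not_not, not_le] at hz
      refine ENNReal.ofReal_le_ofReal ?_
      rw [← dist_eq_norm]
      refine (hunif (a := z.1) (b := z.2) ?_ ⟨hz.1.1, hz.1.2⟩).le
      have h1 := hz.2.1
      have h2 := hz.2.2
      rw [edist_dist, ENNReal.ofReal_lt_ofReal_iff hr] at h1 h2
      exact max_lt h1 h2
  calc ∫⁻ z, ‖f z.1 - f z.2‖ₑ ∂Θ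
      ≤ ∫⁻ z, (ENNReal.ofReal t + S.indicator (fun _ => ENNReal.ofReal (2 * M)) z) ∂Θ :=
        lintegral_mono hpt
    _ = ENNReal.ofReal t + ENNReal.ofReal (2 * M) * Θ S := by
        rw [lintegral_add_left measurable_const, lintegral_const, measure_univ, mul_one,
          lintegral_indicator_const hSm]
    _ ≤ ENNReal.ofReal t + ENNReal.ofReal (2 * M) * ENNReal.ofReal (4 * t) := by gcongr
    _ = ENNReal.ofReal (t + 2 * M * (4 * t)) := by
        rw [← ENNReal.ofReal_mul (by positivity), ← ENNReal.ofReal_add ht0.le (by positivity)]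
    _ ≤ ENNReal.ofReal ε := by
        refine ENNReal.ofReal_le_ofReal ?_
        have : t * (2 + 8 * M) = ε := by rw [ht]; field_simp
        nlinarith

/-- Integrals of a continuous function of growth of order `p` against the two marginals of a
transport plan are close as soon as the `p`-th power transport cost is small, uniformly over plans
whose first marginal is a coupling of two given measures. -/
theorem exists_forall_abs_integral_sub_le {p : ℝ} (hp : 1 ≤ p) {c : A × B → ℝ}
    (hc : Continuous c) (hcg : GrowthLE p c) (μ : Measure A) (ν : Measure B)
    [IsProbabilityMeasure μ] [IsProbabilityMeasure ν] (hμ : MemPp p μ) (hν : MemPp p ν)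
    {ε : ℝ} (hε : 0 < ε) :
    ∃ δ : ℝ≥0∞, 0 < δ ∧ ∀ Θ : Measure ((A × B) × (A × B)), IsProbabilityMeasure Θ →
      IsCoupling μ ν (Θ.map Prod.fst) → Integrable c (Θ.map Prod.snd) →
      lcost p (Θ.map fun z => (z.1.1, z.2.1)) ≤ δ → lcost p (Θ.map fun z => (z.1.2, z.2.2)) ≤ δ →
      |∫ z, c z ∂(Θ.map Prod.fst) - ∫ z, c z ∂(Θ.map Prod.snd)| ≤ ε := by
  have hp0 : 0 < p := by linarith
  obtain ⟨x₀, y₀, M, hM⟩ := exists_boundedContinuous_edist_le hp0.le hc hcg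
  set L : ℝ≥0 := 2 ^ (p - 1) with hL
  have hLE : (L : ℝ≥0∞) = 2 ^ (p - 1) := by
    rw [hL, ENNReal.coe_rpow_of_nonneg _ (by linarith)]; rfl
  have hL1 : 1 ≤ L := NNReal.one_le_rpow one_le_two (by linarith)
  set s : ℝ≥0 := Real.toNNReal (ε / (12 * (M + 1) * L)) with hs
  have hs' : (s : ℝ) = ε / (12 * (M + 1) * L) := Real.coe_toNNReal _ (by positivity)
  have hL0 : (0 : ℝ) < L := lt_of_lt_of_le one_pos (by exact_mod_cast hL1)
  have hs0 : 0 < s := Real.toNNReal_pos.2 (by positivity)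
  have hsE : (0 : ℝ≥0∞) < s := by exact_mod_cast hs0
  obtain ⟨r₁, hr₁⟩ := exists_lintegral_edist_sub_le hμ x₀ hsE
  obtain ⟨r₂, hr₂⟩ := exists_lintegral_edist_sub_le hν y₀ hsE
  set r := max r₁ r₂ with hr
  have hrL : r ≤ L * r := le_mul_of_one_le_left' hL1
  obtain ⟨f, hf⟩ := hM (L * r)
  obtain ⟨δ, hδ, H⟩ := exists_forall_abs_integral_boundedContinuous_sub_le hp0 μ ν f
    (ε := ε / 3) (by positivity)
  refine ⟨min δ s, lt_min hδ hsE, fun Θ hΘ hΘc hci h1 h2 => ?_⟩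
  have := Measure.isProbabilityMeasure_map (μ := Θ) measurable_fst.aemeasurable
  have := Measure.isProbabilityMeasure_map (μ := Θ) measurable_snd.aemeasurable
  have hfin : (M : ℝ≥0∞) * (L * (s + s) + L * (s + s)) ≤ ENNReal.ofReal (ε / 3) := by
    rw [← ENNReal.ofReal_coe_nnreal (p := M), ← ENNReal.ofReal_coe_nnreal (p := L),
      ← ENNReal.ofReal_coe_nnreal (p := s), ← ENNReal.ofReal_add s.coe_nonneg s.coe_nonneg,
      ← ENNReal.ofReal_mul L.coe_nonneg, ← ENNReal.ofReal_add (by positivity) (by positivity),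
      ← ENNReal.ofReal_mul M.coe_nonneg]
    refine ENNReal.ofReal_le_ofReal ?_
    have e : (s : ℝ) * (12 * (M + 1) * L) = ε := by rw [hs']; field_simp
    have : (0 : ℝ) ≤ s * L := by positivity
    nlinarith
  have t1 : ∫⁻ z, ‖c z - f z‖ₑ ∂(Θ.map Prod.fst) ≤ ENNReal.ofReal (ε / 3) := by
    refine (lintegral_enorm_sub_le hf hΘc).trans (le_trans ?_ hfin)
    have hL1' : (1 : ℝ≥0∞) ≤ L := by exact_mod_cast hL1
    gcongr
    · exact (hr₁ _ ((le_max_left _ _).trans hrL)).trans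
        ((le_add_self).trans (le_mul_of_one_le_left' hL1'))
    · exact (hr₂ _ ((le_max_right _ _).trans hrL)).trans
        ((le_add_self).trans (le_mul_of_one_le_left' hL1'))
  have t2 : ∫⁻ z, ‖c z - f z‖ₑ ∂(Θ.map Prod.snd) ≤ ENNReal.ofReal (ε / 3) := by
    refine (lintegral_enorm_sub_le hf ⟨rfl, rfl⟩).trans (le_trans ?_ hfin)
    gcongr
    · have := lintegral_edist_sub_snd_le hp (Θ.map fun z => (z.1.1, z.2.1)) x₀ r
      rw [Measure.map_map (by fun_prop) (by fun_prop), Measure.map_map (by fun_prop) (by fun_prop),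
        ← hLE] at this
      rw [Measure.map_map (by fun_prop) (by fun_prop)]
      refine this.trans ?_
      gcongr
      · rw [← hΘc.1, Measure.map_map (by fun_prop) (by fun_prop)] at hr₁
        exact hr₁ r (le_max_left _ _)
      · exact h1.trans (min_le_right _ _)
    · have := lintegral_edist_sub_snd_le hp (Θ.map fun z => (z.1.2, z.2.2)) y₀ r
      rw [Measure.map_map (by fun_prop) (by fun_prop), Measure.map_map (by fun_prop) (by fun_prop),
        ← hLE] at this
      rw [Measure.map_map (by fun_prop) (by fun_prop)]
      refine this.trans ?_
      gcongr
      · rw [← hΘc.2, Measure.map_map (by fun_prop) (by fun_prop)] at hr₂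
        exact hr₂ r (le_max_right _ _)
      · exact h2.trans (min_le_right _ _)
  have hε3 : 0 ≤ ε / 3 := by positivity
  have a1 := abs_le.1 (abs_integral_sub_le (hcg.integrable hp0.le hc hμ hν hΘc) (f.integrable _)
    hε3 t1)
  have a2 := abs_le.1 (abs_integral_sub_le hci (f.integrable _) hε3 t2)
  have a3 := abs_le.1 (H Θ hΘ hΘc (h1.trans (min_le_left _ _)) (h2.trans (min_le_left _ _)))
  rw [abs_le]
  constructor <;> linarith [a1.1, a1.2, a2.1, a2.2, a3.1, a3.2]

end Estimate

theorem tendsto_integral_of_weakTendsto {A B : Type*} [MeasurableSpace A] [MetricSpace A]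
    [BorelSpace A] [MeasurableSpace B] [MetricSpace B] [PolishSpace B] [BorelSpace B] {p : ℝ}
    (hp : 0 ≤ p) {c : A × B → ℝ} (hc : Continuous c) (hcg : GrowthLE p c) {μ : Measure A}
    {ν : Measure B} [IsProbabilityMeasure μ] [IsProbabilityMeasure ν] (hμ : MemPp p μ)
    (hν : MemPp p ν) {ρ : ℕ → Measure (A × B)} {π : Measure (A × B)}
    (hρ : ∀ n, IsCoupling μ ν (ρ n)) (hπ : IsCoupling μ ν π) (h : WeakTendsto ρ π) :
    Tendsto (fun n => ∫ z, c z ∂(ρ n)) atTop (𝓝 (∫ z, c z ∂π)) := by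
  obtain ⟨x₀, y₀, M, hM⟩ := exists_boundedContinuous_edist_le hp hc hcg
  rw [Metric.tendsto_atTop']
  intro ε hε
  set s : ℝ≥0 := Real.toNNReal (ε / (8 * (M + 1))) with hs
  have hs' : (s : ℝ) = ε / (8 * (M + 1)) := Real.coe_toNNReal _ (by positivity)
  have hs0 : 0 < s := Real.toNNReal_pos.2 (by positivity)
  have hsE : (0 : ℝ≥0∞) < s := by exact_mod_cast hs0
  obtain ⟨r₁, hr₁⟩ := exists_lintegral_edist_sub_le hμ x₀ hsE
  obtain ⟨r₂, hr₂⟩ := exists_lintegral_edist_sub_le hν y₀ hsE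
  obtain ⟨f, hf⟩ := hM (max r₁ r₂)
  have tail : ∀ ρ : Measure (A × B), IsCoupling μ ν ρ →
      |∫ z, c z ∂ρ - ∫ z, f z ∂ρ| ≤ ε / 4 := by
    intro ρ hρ
    have := hρ.isProbabilityMeasure
    refine abs_integral_sub_le (hcg.integrable hp hc hμ hν hρ) (f.integrable _) (by positivity) ?_
    refine (lintegral_enorm_sub_le hf hρ).trans ?_
    calc (M : ℝ≥0∞) * _ ≤ M * (s + s) := by
          gcongr
          · exact hr₁ _ (le_max_left _ _)
          · exact hr₂ _ (le_max_right _ _)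
      _ = ENNReal.ofReal (M * (s + s)) := by
          rw [← ENNReal.ofReal_coe_nnreal (p := M), ← ENNReal.ofReal_coe_nnreal (p := s),
            ← ENNReal.ofReal_add s.coe_nonneg s.coe_nonneg, ← ENNReal.ofReal_mul M.coe_nonneg]
      _ ≤ _ := by
          refine ENNReal.ofReal_le_ofReal ?_
          have e : (s : ℝ) * (8 * (M + 1)) = ε := by rw [hs']; field_simp
          have : (0 : ℝ) ≤ s := s.coe_nonneg
          nlinarith
  obtain ⟨n₀, hn₀⟩ := Metric.tendsto_atTop'.1 (h f) (ε / 4) (by positivity)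
  refine ⟨n₀, fun n hn => ?_⟩
  have a1 := abs_le.1 (tail _ (hρ n))
  have a2 := abs_le.1 (tail _ hπ)
  have a3 := abs_lt.1 (hn₀ n hn)
  rw [Real.dist_eq, abs_lt]
  constructor <;> linarith [a1.1, a1.2, a2.1, a2.2, a3.1, a3.2]

theorem condExpIndep_iff_setIntegral {Ω : Type*} {m₁ m₂ m₃ mΩ : MeasurableSpace Ω}
    {P : Measure Ω} [IsProbabilityMeasure P] (h₁ : m₁ ≤ mΩ) (h₂ : m₂ ≤ mΩ) (h₃ : m₃ ≤ mΩ) :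
    CondExpIndep m₁ m₂ m₃ P ↔ ∀ B A C, MeasurableSet[m₂] B → MeasurableSet[m₁] A →
      MeasurableSet[m₃] C → ∫ ω in A ∩ C, B.indicator (fun _ => (1 : ℝ)) ω ∂P =
        ∫ ω in A ∩ C, (P[B.indicator (fun _ => (1 : ℝ)) | m₃]) ω ∂P := by
  constructor
  · intro H B A C hB hA hC
    have hAC : MeasurableSet[m₁ ⊔ m₃] (A ∩ C) := MeasurableSet.inter
      ((le_sup_left : m₁ ≤ m₁ ⊔ m₃) _ hA) ((le_sup_right : m₃ ≤ m₁ ⊔ m₃) _ hC)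
    rw [← setIntegral_condExp (sup_le h₁ h₃) (integrable_indicator_one (h₂ _ hB)) hAC]
    exact integral_congr_ae (ae_restrict_of_ae (H B hB))
  · intro H B hB
    exact (ae_eq_condExp_sup h₁ h₃ (integrable_indicator_one (h₂ _ hB)) integrable_condExp
      stronglyMeasurable_condExp.aestronglyMeasurable fun A C hA hC => H B A C hB hA hC).symm

section Closed

variable {A B : Type*} [MeasurableSpace A] [MetricSpace A] [BorelSpace A]
  [MeasurableSpace B] [MetricSpace B] [BorelSpace B]

theorem WeakTendsto.map {πs : ℕ → Measure A} {π : Measure A} (h : WeakTendsto πs π) {g : A → B}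
    (hg : Continuous g) : WeakTendsto (fun n => (πs n).map g) (π.map g) := by
  intro f
  have e : ∀ ρ : Measure A, ∫ y, f y ∂(ρ.map g) = ∫ x, f.compContinuous ⟨g, hg⟩ x ∂ρ := fun ρ =>
    integral_map hg.measurable.aemeasurable f.continuous.measurable.aestronglyMeasurable
  simpa only [e] using h (f.compContinuous ⟨g, hg⟩)

theorem WeakTendsto.eq_of_const {μ π : Measure A} [IsFiniteMeasure μ] [IsFiniteMeasure π]
    (h : WeakTendsto (fun _ => μ) π) : π = μ :=
  ext_of_forall_integral_eq_of_IsFiniteMeasure fun f =>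
    tendsto_nhds_unique (h f) tendsto_const_nhds |>.symm ▸ rfl

variable [SecondCountableTopology B]

theorem IsCoupling.of_weakTendsto {μ : Measure A} {ν : Measure B} [IsProbabilityMeasure μ]
    [IsProbabilityMeasure ν] {ρ : ℕ → Measure (A × B)} {π : Measure (A × B)}
    [IsProbabilityMeasure π] (hρ : ∀ n, IsCoupling μ ν (ρ n)) (h : WeakTendsto ρ π) :
    IsCoupling μ ν π := by
  have h1 := h.map continuous_fst
  have h2 := h.map continuous_snd
  simp only [(hρ _).1] at h1
  simp only [(hρ _).2] at h2
  exact ⟨h1.eq_of_const, h2.eq_of_const⟩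

variable [SecondCountableTopology A]

/-- Weak convergence of couplings of two fixed measures implies convergence of integrals of
products of merely integrable functions of each coordinate. -/
theorem tendsto_integral_mul_of_weakTendsto {μ : Measure A} {ν : Measure B}
    [IsProbabilityMeasure μ] [IsProbabilityMeasure ν] {ρ : ℕ → Measure (A × B)}
    {π : Measure (A × B)} (hρ : ∀ n, IsCoupling μ ν (ρ n)) (hπ : IsCoupling μ ν π)
    (h : WeakTendsto ρ π) {f : A → ℝ} {g : B → ℝ} (hf : Integrable f μ) (hg : Measurable g)
    {C : ℝ} (hgC : ∀ y, |g y| ≤ C) :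
    Tendsto (fun n => ∫ z, f z.1 * g z.2 ∂(ρ n)) atTop (𝓝 (∫ z, f z.1 * g z.2 ∂π)) := by
  rw [Metric.tendsto_atTop']
  intro ε hε
  have hC0 : 0 ≤ C := by
    have : Nonempty B := nonempty_of_isProbabilityMeasure ν
    exact (abs_nonneg _).trans (hgC (Classical.arbitrary B))
  have hgi : Integrable g ν := Integrable.of_bound hg.aestronglyMeasurable C (ae_of_all _ hgC)
  obtain ⟨f', hf', -⟩ := hf.exists_boundedContinuous_integral_sub_le
    (ε := ε / (8 * (C + 1))) (by positivity)
  obtain ⟨g', hg', -⟩ := hgi.exists_boundedContinuous_integral_sub_le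
    (ε := ε / (8 * (‖f'‖ + 1))) (by positivity)
  set F : BoundedContinuousFunction (A × B) ℝ :=
    f'.compContinuous ⟨Prod.fst, continuous_fst⟩ * g'.compContinuous ⟨Prod.snd, continuous_snd⟩
    with hF
  have hFz : ∀ z, F z = f' z.1 * g' z.2 := fun z => rfl
  have approx : ∀ ρ : Measure (A × B), IsCoupling μ ν ρ →
      |∫ z, f z.1 * g z.2 ∂ρ - ∫ z, F z ∂ρ| ≤ ε / 4 := by
    intro ρ hρ
    have := hρ.isProbabilityMeasure
    have hf1 : Integrable (fun z : A × B => f z.1) ρ := by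
      rw [← hρ.1] at hf; exact hf.comp_measurable measurable_fst
    have hfg : Integrable (fun z : A × B => f z.1 * g z.2) ρ :=
      hf1.mul_bdd (c := C) (hg.comp measurable_snd).aestronglyMeasurable
        (ae_of_all _ fun z => hgC _)
    have d1 : Integrable (fun x => ‖f x - f' x‖) μ := (hf.sub (f'.integrable μ)).norm
    have d2 : Integrable (fun y => ‖g y - g' y‖) ν := (hgi.sub (g'.integrable ν)).norm
    have i1 : ∫ z, ‖f z.1 - f' z.1‖ ∂ρ = ∫ x, ‖f x - f' x‖ ∂μ := by
      rw [← hρ.1] at d1 ⊢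
      exact (integral_map measurable_fst.aemeasurable d1.aestronglyMeasurable).symm
    have i2 : ∫ z, ‖g z.2 - g' z.2‖ ∂ρ = ∫ y, ‖g y - g' y‖ ∂ν := by
      rw [← hρ.2] at d2 ⊢
      exact (integral_map measurable_snd.aemeasurable d2.aestronglyMeasurable).symm
    have j1 : Integrable (fun z : A × B => ‖f z.1 - f' z.1‖) ρ := by
      rw [← hρ.1] at d1; exact d1.comp_measurable measurable_fst
    have j2 : Integrable (fun z : A × B => ‖g z.2 - g' z.2‖) ρ := by
      rw [← hρ.2] at d2; exact d2.comp_measurable measurable_snd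
    rw [← integral_sub hfg (F.integrable ρ)]
    calc |∫ z, (f z.1 * g z.2 - F z) ∂ρ|
        ≤ ∫ z, (C * ‖f z.1 - f' z.1‖ + ‖f'‖ * ‖g z.2 - g' z.2‖) ∂ρ := by
          rw [← Real.norm_eq_abs]
          refine norm_integral_le_of_norm_le ((j1.const_mul _).add (j2.const_mul _))
            (ae_of_all _ fun z => ?_)
          have e : f z.1 * g z.2 - F z =
              (f z.1 - f' z.1) * g z.2 + f' z.1 * (g z.2 - g' z.2) := by rw [hFz]; ring
          rw [e]
          refine (norm_add_le _ _).trans ?_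
          rw [norm_mul, norm_mul, mul_comm ‖f z.1 - f' z.1‖]
          gcongr
          · exact hgC _
          · exact f'.norm_coe_le_norm _
      _ = C * ∫ x, ‖f x - f' x‖ ∂μ + ‖f'‖ * ∫ y, ‖g y - g' y‖ ∂ν := by
          rw [integral_add (j1.const_mul _) (j2.const_mul _), integral_const_mul,
            integral_const_mul, i1, i2]
      _ ≤ C * (ε / (8 * (C + 1))) + ‖f'‖ * (ε / (8 * (‖f'‖ + 1))) := by gcongr
      _ ≤ ε / 4 := by
          have key : ∀ a : ℝ, 0 ≤ a → a * (ε / (8 * (a + 1))) ≤ ε / 8 := by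
            intro a ha
            rw [mul_div_assoc', div_le_div_iff₀ (by positivity) (by positivity)]
            nlinarith
          linarith [key C hC0, key ‖f'‖ (norm_nonneg _)]
  obtain ⟨n₀, hn₀⟩ := Metric.tendsto_atTop'.1 (h F) (ε / 4) (by positivity)
  refine ⟨n₀, fun n hn => ?_⟩
  have a1 := abs_le.1 (approx _ (hρ n))
  have a2 := abs_le.1 (approx _ hπ)
  have a3 := abs_lt.1 (hn₀ n hn)
  rw [Real.dist_eq, abs_lt]
  constructor <;> linarith [a1.1, a1.2, a2.1, a2.2, a3.1, a3.2]

end Closed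

section PathSpace

variable {X Y : Fin N → Type*} [∀ t, MeasurableSpace (X t)] [∀ t, MeasurableSpace (Y t)]

theorem pastσ_le (t : ℕ) : pastσ X t ≤ MeasurableSpace.pi :=
  (pastσOf_le_iSup _ t).trans (iSup_le coordσ_le)

/-- Causality of a coupling as a family of linear constraints. -/
theorem isCausal_iff_integral_eq_zero {μ : Measure (∀ t, X t)} {ν : Measure (∀ t, Y t)}
    [IsProbabilityMeasure μ] {π : Measure ((∀ t, X t) × (∀ t, Y t))} (hπ : IsCoupling μ ν π) :
    IsCausal π ↔ ∀ (t : Fin N) (A C : Set (∀ t, X t)) (D : Set (∀ t, Y t)),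
      MeasurableSet[coordσ X t] A → MeasurableSet[pastσ X t] C → MeasurableSet[pastσ Y t] D →
      ∫ z, C.indicator (fun x => A.indicator (fun _ => (1 : ℝ)) x -
        (μ[A.indicator (fun _ => (1 : ℝ)) | pastσ X t]) x) z.1 *
          D.indicator (fun _ => (1 : ℝ)) z.2 ∂π = 0 := by
  have := hπ.isProbabilityMeasure
  have hμ := hπ.1
  refine forall_congr' fun t => ?_
  have lX := coordσ_le (X := X) t
  have lp := pastσ_le (X := X) t
  have lq := pastσ_le (X := Y) t
  have c1 : (coordσ X t).comap (Prod.fst : (∀ t, X t) × (∀ t, Y t) → _) ≤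
      Prod.instMeasurableSpace := (MeasurableSpace.comap_mono lX).trans measurable_fst.comap_le
  have c2 : (pastσ X t).comap (Prod.fst : (∀ t, X t) × (∀ t, Y t) → _) ≤
      Prod.instMeasurableSpace := (MeasurableSpace.comap_mono lp).trans measurable_fst.comap_le
  have c3 : (pastσ Y t).comap (Prod.snd : (∀ t, X t) × (∀ t, Y t) → _) ≤
      Prod.instMeasurableSpace := (MeasurableSpace.comap_mono lq).trans measurable_snd.comap_le
  have hiff : CondIndepσ ((coordσ X t).comap Prod.fst) ((pastσ Y t).comap Prod.snd)
      ((pastσ X t).comap Prod.fst) π ↔ CondExpIndep ((pastσ Y t).comap Prod.snd)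
      ((coordσ X t).comap Prod.fst) ((pastσ X t).comap Prod.fst) π := by
    rw [condExpIndep_iff c3 c1 c2]
    exact ⟨CondIndepσ.symm, CondIndepσ.symm⟩
  refine hiff.trans ((condExpIndep_iff_setIntegral c3 c1 c2).trans ?_)
  have key : ∀ (A C : Set (∀ t, X t)) (D : Set (∀ t, Y t)), MeasurableSet[coordσ X t] A →
      MeasurableSet[pastσ X t] C → MeasurableSet[pastσ Y t] D →
      ∫ z, C.indicator (fun x => A.indicator (fun _ => (1 : ℝ)) x -
        (μ[A.indicator (fun _ => (1 : ℝ)) | pastσ X t]) x) z.1 *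
          D.indicator (fun _ => (1 : ℝ)) z.2 ∂π =
      ∫ z in Prod.snd ⁻¹' D ∩ Prod.fst ⁻¹' C,
        (Prod.fst ⁻¹' A).indicator (fun _ => (1 : ℝ)) z ∂π -
      ∫ z in Prod.snd ⁻¹' D ∩ Prod.fst ⁻¹' C,
        (π[(Prod.fst ⁻¹' A).indicator (fun _ => (1 : ℝ)) | (pastσ X t).comap Prod.fst]) z ∂π := by
    intro A C D hA hC hD
    have hS : MeasurableSet (Prod.snd ⁻¹' D ∩ Prod.fst ⁻¹' C : Set ((∀ t, X t) × (∀ t, Y t))) :=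
      (measurable_snd (lq _ hD)).inter (measurable_fst (lp _ hC))
    have hA' : MeasurableSet (Prod.fst ⁻¹' A : Set ((∀ t, X t) × (∀ t, Y t))) :=
      measurable_fst (lX _ hA)
    rw [← integral_sub (integrable_indicator_one hA').integrableOn
      integrable_condExp.integrableOn, ← integral_indicator hS]
    have hce := condExp_map_comp (P := π) (f := Prod.fst) lp measurable_fst
      (g := A.indicator fun _ => (1 : ℝ))
      (by rw [hμ]; exact integrable_indicator_one (lX _ hA))
    rw [hμ] at hce
    refine integral_congr_ae ?_
    filter_upwards [hce] with z hz
    have hz' : (μ[A.indicator (fun _ => (1 : ℝ)) | pastσ X t]) z.1 =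
      (π[(Prod.fst ⁻¹' A).indicator (fun _ => (1 : ℝ)) | (pastσ X t).comap Prod.fst]) z := hz
    have hz2 : A.indicator (fun _ => (1 : ℝ)) z.1 =
      (Prod.fst ⁻¹' A : Set ((∀ t, X t) × (∀ t, Y t))).indicator (fun _ => (1 : ℝ)) z := rfl
    by_cases h1 : z.1 ∈ C <;> by_cases h2 : z.2 ∈ D <;>
      simp [h1, h2, ← hz', ← hz2, indicator_of_mem, indicator_of_notMem]
  constructor
  · intro H A C D hA hC hD
    rw [key A C D hA hC hD, sub_eq_zero]
    exact H _ _ _ ⟨A, hA, rfl⟩ ⟨D, hD, rfl⟩ ⟨C, hC, rfl⟩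
  · rintro H _ _ _ ⟨A, hA, rfl⟩ ⟨D, hD, rfl⟩ ⟨C, hC, rfl⟩
    have := H A C D hA hC hD
    rwa [key A C D hA hC hD, sub_eq_zero] at this

end PathSpace

section PathSpace

variable {X Y : Fin N → Type*} [∀ t, MeasurableSpace (X t)] [∀ t, MetricSpace (X t)]
  [∀ t, PolishSpace (X t)] [∀ t, BorelSpace (X t)] [∀ t, MeasurableSpace (Y t)]
  [∀ t, MetricSpace (Y t)] [∀ t, PolishSpace (Y t)] [∀ t, BorelSpace (Y t)]

theorem IsCausal.of_weakTendsto {μ : Measure (∀ t, X t)} {ν : Measure (∀ t, Y t)}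
    [IsProbabilityMeasure μ] [IsProbabilityMeasure ν]
    {ρ : ℕ → Measure ((∀ t, X t) × (∀ t, Y t))} {π : Measure ((∀ t, X t) × (∀ t, Y t))}
    (hρ : ∀ n, IsCoupling μ ν (ρ n)) (hπ : IsCoupling μ ν π) (h : WeakTendsto ρ π)
    (hc : ∀ n, IsCausal (ρ n)) : IsCausal π := by
  rw [isCausal_iff_integral_eq_zero hπ]
  intro t A C D hA hC hD
  have hlim := tendsto_integral_mul_of_weakTendsto hρ hπ h
    (f := C.indicator fun x => A.indicator (fun _ => (1 : ℝ)) x -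
        (μ[A.indicator (fun _ => (1 : ℝ)) | pastσ X t]) x)
    (g := D.indicator fun _ => (1 : ℝ))
    (((integrable_indicator_one (coordσ_le t _ hA)).sub integrable_condExp).indicator
      (pastσ_le t _ hC))
    (measurable_const.indicator (pastσ_le t _ hD)) (C := 1) (fun y => by
      by_cases hy : y ∈ D <;> simp [hy])
  refine tendsto_nhds_unique hlim (tendsto_const_nhds.congr fun n => ?_)
  exact ((isCausal_iff_integral_eq_zero (hρ n)).1 (hc n) t A C D hA hC hD).symm

theorem mem_aCouplings_of_weakTendsto {b : Flavor} {μ : Measure (∀ t, X t)}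
    {ν : Measure (∀ t, Y t)} [IsProbabilityMeasure μ] [IsProbabilityMeasure ν]
    {ρ : ℕ → Measure ((∀ t, X t) × (∀ t, Y t))} {π : Measure ((∀ t, X t) × (∀ t, Y t))}
    [IsProbabilityMeasure π] (hρ : ∀ n, ρ n ∈ aCouplings b μ ν) (h : WeakTendsto ρ π) :
    π ∈ aCouplings b μ ν := by
  have hπ : IsCoupling μ ν π := .of_weakTendsto (fun n => (hρ n).1) h
  have hc : (∀ n, IsCausal (ρ n)) → IsCausal π := .of_weakTendsto (fun n => (hρ n).1) hπ h
  have hac : (∀ n, IsAnticausal (ρ n)) → IsAnticausal π := fun H =>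
    IsCausal.of_weakTendsto (fun n => (hρ n).1.swap) hπ.swap (h.map continuous_swap) H
  refine ⟨hπ, ?_⟩
  cases b
  exacts [trivial, hc fun n => (hρ n).2, hac fun n => (hρ n).2,
    ⟨hc fun n => (hρ n).2.1, hac fun n => (hρ n).2.2⟩]

end PathSpace

theorem GrowthLE.exists_forall_abs_integral_le {A B : Type*} [MeasurableSpace A] [MetricSpace A]
    [BorelSpace A] [MeasurableSpace B] [MetricSpace B] [PolishSpace B] [BorelSpace B] {p : ℝ}
    (hp : 0 ≤ p) {c : A × B → ℝ} (hc : Continuous c) (hcg : GrowthLE p c) {μ : Measure A}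
    {ν : Measure B} [IsProbabilityMeasure μ] (hμ : MemPp p μ) (hν : MemPp p ν) :
    ∃ R : ℝ, ∀ π : Measure (A × B), IsCoupling μ ν π → |∫ z, c z ∂π| ≤ R := by
  obtain ⟨x₀, y₀, M, h⟩ := exists_boundedContinuous_edist_le hp hc hcg
  obtain ⟨f, hf⟩ := h 0
  set K : ℝ≥0∞ := M * (∫⁻ x, (edist x₀ x ^ p - (0 : ℝ≥0)) ∂μ +
    ∫⁻ y, (edist y₀ y ^ p - (0 : ℝ≥0)) ∂ν) with hKdef
  have hK : K ≠ ⊤ := by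
    simp only [hKdef, ENNReal.coe_zero, tsub_zero]
    exact ENNReal.mul_ne_top ENNReal.coe_ne_top (ENNReal.add_ne_top.2 ⟨hμ x₀, hν y₀⟩)
  refine ⟨‖f‖ + K.toReal, fun π hπ => ?_⟩
  have := hπ.isProbabilityMeasure
  have h1 := abs_le.1 (abs_integral_sub_le (hcg.integrable hp hc hμ hν hπ) (f.integrable π)
    ENNReal.toReal_nonneg ((lintegral_enorm_sub_le hf hπ).trans (ENNReal.ofReal_toReal hK).ge))
  have h2 := abs_le.1 (f.norm_integral_le_norm π)
  rw [abs_le]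
  constructor <;> linarith [h1.1, h1.2, h2.1, h2.2]

theorem exists_integral_lt_V_add {X Y : Fin N → Type*} [∀ t, MeasurableSpace (X t)]
    [∀ t, MeasurableSpace (Y t)] (c : (∀ t, X t) × (∀ t, Y t) → ℝ)
    (μ : Measure (∀ t, X t)) (ν : Measure (∀ t, Y t)) [IsProbabilityMeasure μ]
    [IsProbabilityMeasure ν] (b : Flavor) {ε : ℝ} (hε : 0 < ε) :
    ∃ π ∈ aCouplings b μ ν, ∫ z, c z ∂π < V b μ ν c + ε := by
  have : Nonempty (aCouplings b μ ν) := ⟨⟨_, prod_mem_aCouplings b μ ν⟩⟩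
  obtain ⟨π, hπ⟩ := exists_lt_of_ciInf_lt (lt_add_of_pos_right (V b μ ν c) hε)
  exact ⟨π.1, π.2, hπ⟩

section PathSpace

variable {X Y : Fin N → Type*} [∀ t, MeasurableSpace (X t)] [∀ t, MetricSpace (X t)]
  [∀ t, PolishSpace (X t)] [∀ t, BorelSpace (X t)] [∀ t, MeasurableSpace (Y t)]
  [∀ t, MetricSpace (Y t)] [∀ t, PolishSpace (Y t)] [∀ t, BorelSpace (Y t)]

theorem V_le_integral {p : ℝ} (hp : 0 ≤ p) {c : (∀ t, X t) × (∀ t, Y t) → ℝ}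
    (hc : Continuous c) (hcg : GrowthLE p c) {μ : Measure (∀ t, X t)} {ν : Measure (∀ t, Y t)}
    [IsProbabilityMeasure μ] (hμ : MemPp p μ) (hν : MemPp p ν) {b : Flavor}
    {π : Measure ((∀ t, X t) × (∀ t, Y t))} (hπ : π ∈ aCouplings b μ ν) :
    V b μ ν c ≤ ∫ z, c z ∂π := by
  obtain ⟨R, hR⟩ := hcg.exists_forall_abs_integral_le hp hc hμ hν
  have hbdd : BddBelow (range fun π : aCouplings b μ ν => ∫ z, c z ∂π.1) :=
    ⟨-R, forall_mem_range.2 fun π => (abs_le.1 (hR π.1 π.2.1)).1⟩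
  exact ciInf_le hbdd ⟨π, hπ⟩

/-- Along sequences of marginals converging in the bicausal Wasserstein distance, every
adapted coupling of the approximating marginals is close to an adapted coupling of the limits,
and conversely. -/
theorem eventually_exists_transport {p : ℝ} (hp : 0 < p) {μ : Measure (∀ t, X t)}
    {ν : Measure (∀ t, Y t)} [IsProbabilityMeasure μ] [IsProbabilityMeasure ν]
    {μs : ℕ → Measure (∀ t, X t)} {νs : ℕ → Measure (∀ t, Y t)}
    (hμs : ∀ n, IsProbabilityMeasure (μs n)) (hνs : ∀ n, IsProbabilityMeasure (νs n))
    (hμ : Tendsto (fun n => W p .bicausal (μs n) μ) atTop (𝓝 0))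
    (hν : Tendsto (fun n => W p .bicausal (νs n) ν) atTop (𝓝 0))
    (b : Flavor) {δ : ℝ≥0∞} (hδ : 0 < δ) :
    ∀ᶠ n in atTop,
      (∀ π ∈ aCouplings b (μs n) (νs n), ∃ Θ, IsProbabilityMeasure Θ ∧
        Θ.map Prod.fst ∈ aCouplings b μ ν ∧ Θ.map Prod.snd = π ∧
        lcost p (Θ.map fun z => (z.1.1, z.2.1)) ≤ δ ∧
        lcost p (Θ.map fun z => (z.1.2, z.2.2)) ≤ δ) ∧
      (∀ π ∈ aCouplings b μ ν, ∃ Θ, IsProbabilityMeasure Θ ∧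
        Θ.map Prod.fst = π ∧ Θ.map Prod.snd ∈ aCouplings b (μs n) (νs n) ∧
        lcost p (Θ.map fun z => (z.1.1, z.2.1)) ≤ δ ∧
        lcost p (Θ.map fun z => (z.1.2, z.2.2)) ≤ δ) := by
  filter_upwards [exists_lcost_lt_of_tendsto_W hp hμ hδ, exists_lcost_lt_of_tendsto_W hp hν hδ]
  rintro n ⟨γ, hγ, hγδ⟩ ⟨η, hη, hηδ⟩
  have := hμs n
  have := hνs n
  constructor
  · intro π hπ
    obtain ⟨Θ, hΘ, h1, h2, h3, h4⟩ := exists_shadow b hγ hη hπ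
    refine ⟨Θ.map Prod.swap, Measure.isProbabilityMeasure_map measurable_swap.aemeasurable,
      ?_, ?_, ?_, ?_⟩
    · rw [Measure.map_map measurable_fst measurable_swap]
      exact h2
    · rw [Measure.map_map measurable_snd measurable_swap]
      exact h1
    · have e : (Θ.map Prod.swap).map (fun z => (z.1.1, z.2.1)) = γ.map Prod.swap := by
        rw [← h3, Measure.map_map (by fun_prop) measurable_swap,
          Measure.map_map measurable_swap (by fun_prop)]
        rfl
      rw [e, lcost_map_swap]
      exact hγδ.le
    · have e : (Θ.map Prod.swap).map (fun z => (z.1.2, z.2.2)) = η.map Prod.swap := by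
        rw [← h4, Measure.map_map (by fun_prop) measurable_swap,
          Measure.map_map measurable_swap (by fun_prop)]
        rfl
      rw [e, lcost_map_swap]
      exact hηδ.le
  · intro π hπ
    obtain ⟨Θ, hΘ, h1, h2, h3, h4⟩ := exists_shadow b (swap_mem_aCouplings_bicausal hγ)
      (swap_mem_aCouplings_bicausal hη) hπ
    refine ⟨Θ, hΘ, h1, h2, ?_, ?_⟩
    · rw [h3, lcost_map_swap]
      exact hγδ.le
    · rw [h4, lcost_map_swap]
      exact hηδ.le

theorem tendsto_V {p : ℝ} (hp : 1 ≤ p) {c : (∀ t, X t) × (∀ t, Y t) → ℝ} (hc : Continuous c)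
    (hcg : GrowthLE p c) {μ : Measure (∀ t, X t)} {ν : Measure (∀ t, Y t)}
    [IsProbabilityMeasure μ] [IsProbabilityMeasure ν] (hμp : MemPp p μ) (hνp : MemPp p ν)
    {μs : ℕ → Measure (∀ t, X t)} {νs : ℕ → Measure (∀ t, Y t)}
    (hμs : ∀ n, IsProbabilityMeasure (μs n)) (hνs : ∀ n, IsProbabilityMeasure (νs n))
    (hμsp : ∀ n, MemPp p (μs n)) (hνsp : ∀ n, MemPp p (νs n))
    (hμ : Tendsto (fun n => W p .bicausal (μs n) μ) atTop (𝓝 0))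
    (hν : Tendsto (fun n => W p .bicausal (νs n) ν) atTop (𝓝 0)) (b : Flavor) :
    Tendsto (fun n => V b (μs n) (νs n) c) atTop (𝓝 (V b μ ν c)) := by
  have hp0 : 0 < p := by linarith
  refine Metric.tendsto_nhds.2 fun ε hε => ?_
  obtain ⟨δ, hδ, H⟩ := exists_forall_abs_integral_sub_le hp hc hcg μ ν hμp hνp
    (ε := ε / 4) (by positivity)
  filter_upwards [eventually_exists_transport hp0 hμs hνs hμ hν b hδ] with n hn
  have := hμs n
  have := hνs n
  rw [Real.dist_eq, abs_lt]
  constructor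
  · obtain ⟨π, hπ, hπV⟩ := exists_integral_lt_V_add c (μs n) (νs n) b (ε := ε / 4) (by positivity)
    obtain ⟨Θ, hΘ, h1, rfl, h3, h4⟩ := hn.1 π hπ
    have hle := V_le_integral hp0.le hc hcg hμp hνp h1
    have hd := H Θ hΘ h1.1 (hcg.integrable hp0.le hc (hμsp n) (hνsp n) hπ.1) h3 h4
    linarith [(abs_le.1 hd).2]
  · obtain ⟨π, hπ, hπV⟩ := exists_integral_lt_V_add c μ ν b (ε := ε / 4) (by positivity)
    obtain ⟨Θ, hΘ, rfl, h2, h3, h4⟩ := hn.2 π hπ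
    have hle := V_le_integral hp0.le hc hcg (hμsp n) (hνsp n) h2
    have hd := H Θ hΘ hπ.1 (hcg.integrable hp0.le hc (hμsp n) (hνsp n) h2.1) h3 h4
    linarith [(abs_le.1 hd).1]

/-- A weak limit of adapted couplings of marginals converging in the bicausal Wasserstein
distance is an adapted coupling of the limits, and integrals of functions of growth of order `p`
converge along a subsequence. -/
theorem exists_tendsto_integral_of_weakTendsto {p : ℝ} (hp : 1 ≤ p)
    {c : (∀ t, X t) × (∀ t, Y t) → ℝ} (hc : Continuous c)
    (hcg : GrowthLE p c) {μ : Measure (∀ t, X t)} {ν : Measure (∀ t, Y t)}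
    [IsProbabilityMeasure μ] [IsProbabilityMeasure ν] (hμp : MemPp p μ) (hνp : MemPp p ν)
    {μs : ℕ → Measure (∀ t, X t)} {νs : ℕ → Measure (∀ t, Y t)}
    (hμs : ∀ n, IsProbabilityMeasure (μs n)) (hνs : ∀ n, IsProbabilityMeasure (νs n))
    (hμsp : ∀ n, MemPp p (μs n)) (hνsp : ∀ n, MemPp p (νs n))
    (hμ : Tendsto (fun n => W p .bicausal (μs n) μ) atTop (𝓝 0))
    (hν : Tendsto (fun n => W p .bicausal (νs n) ν) atTop (𝓝 0)) {b : Flavor}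
    {πs : ℕ → Measure ((∀ t, X t) × (∀ t, Y t))}
    (hπs : ∀ n, πs n ∈ aCouplings b (μs n) (νs n)) {π : Measure ((∀ t, X t) × (∀ t, Y t))}
    [IsProbabilityMeasure π] (h : WeakTendsto πs π) :
    π ∈ aCouplings b μ ν ∧ ∃ ψ : ℕ → ℕ, StrictMono ψ ∧
      Tendsto (fun m => ∫ z, c z ∂(πs (ψ m))) atTop (𝓝 (∫ z, c z ∂π)) := by
  have hp0 : 0 < p := by linarith
  have hex : ∀ m : ℕ, ∀ᶠ n in atTop, ∃ Θ, IsProbabilityMeasure Θ ∧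
      Θ.map Prod.fst ∈ aCouplings b μ ν ∧ Θ.map Prod.snd = πs n ∧
      lcost p (Θ.map fun z => (z.1.1, z.2.1)) ≤ (m + 1 : ℝ≥0∞)⁻¹ ∧
      lcost p (Θ.map fun z => (z.1.2, z.2.2)) ≤ (m + 1 : ℝ≥0∞)⁻¹ := fun m => by
    have hm : (0 : ℝ≥0∞) < (m + 1 : ℝ≥0∞)⁻¹ :=
      ENNReal.inv_pos.2 (ENNReal.add_ne_top.2 ⟨ENNReal.natCast_ne_top m, ENNReal.one_ne_top⟩)
    filter_upwards [eventually_exists_transport hp0 hμs hνs hμ hν b hm] with n hn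
    exact hn.1 _ (hπs n)
  obtain ⟨ψ, hψ, H⟩ := extraction_forall_of_eventually hex
  choose Θ hΘ hfst hsnd hX hY using H
  have hsmall : ∀ δ : ℝ≥0∞, 0 < δ → ∀ᶠ m : ℕ in atTop, (m + 1 : ℝ≥0∞)⁻¹ ≤ δ := by
    intro δ hδ
    obtain ⟨k, hk⟩ := ENNReal.exists_inv_nat_lt hδ.ne'
    filter_upwards [eventually_ge_atTop k] with m hm
    refine le_trans (ENNReal.inv_le_inv.2 ?_) hk.le
    exact le_add_right (by exact_mod_cast hm)
  have key : ∀ f : (∀ t, X t) × (∀ t, Y t) → ℝ, (∀ ε : ℝ, 0 < ε → ∃ δ : ℝ≥0∞, 0 < δ ∧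
      ∀ m : ℕ, (m + 1 : ℝ≥0∞)⁻¹ ≤ δ →
        |∫ z, f z ∂((Θ m).map Prod.fst) - ∫ z, f z ∂(πs (ψ m))| ≤ ε) →
      Tendsto (fun m => ∫ z, f z ∂((Θ m).map Prod.fst) - ∫ z, f z ∂(πs (ψ m))) atTop (𝓝 0) := by
    intro f hf
    refine Metric.tendsto_nhds.2 fun ε hε => ?_
    obtain ⟨δ, hδ, hd⟩ := hf (ε / 2) (half_pos hε)
    filter_upwards [hsmall δ hδ] with m hm
    rw [dist_zero_right, Real.norm_eq_abs]
    linarith [hd m hm]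
  have hweak : WeakTendsto (fun m => (Θ m).map Prod.fst) π := by
    intro f
    have hf := key f fun ε hε => by
      obtain ⟨δ, hδ, hd⟩ := exists_forall_abs_integral_boundedContinuous_sub_le hp0 μ ν f hε
      refine ⟨δ, hδ, fun m hm => ?_⟩
      rw [← hsnd m]
      exact hd _ (hΘ m) (hfst m).1 ((hX m).trans hm) ((hY m).trans hm)
    simpa using hf.add ((h f).comp hψ.tendsto_atTop)
  have hmem : π ∈ aCouplings b μ ν := mem_aCouplings_of_weakTendsto hfst hweak
  refine ⟨hmem, ψ, hψ, ?_⟩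
  have hcdiff := key c fun ε hε => by
    obtain ⟨δ, hδ, hd⟩ := exists_forall_abs_integral_sub_le hp hc hcg μ ν hμp hνp hε
    refine ⟨δ, hδ, fun m hm => ?_⟩
    have := hμs (ψ m)
    have hci := hcg.integrable hp0.le hc (hμsp (ψ m)) (hνsp (ψ m)) (hπs (ψ m)).1
    rw [← hsnd m] at hci ⊢
    exact hd _ (hΘ m) (hfst m).1 hci ((hX m).trans hm) ((hY m).trans hm)
  have hclim := tendsto_integral_of_weakTendsto hp0.le hc hcg hμp hνp (fun m => (hfst m).1)
    hmem.1 hweak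
  simpa using hclim.sub hcdiff

end PathSpace

/-- Qualitative stability of adapted optimal transport: if
`W_{p,bc}(μⁿ, μ) → 0` and `W_{p,bc}(νⁿ, ν) → 0`, then
`V_•(μⁿ, νⁿ, c) → V_•(μ, ν, c)`, and every weak accumulation point of optimizers of
`V_•(μⁿ, νⁿ, c)` is an optimizer of `V_•(μ, ν, c)`. -/
theorem stmt_7 {N : ℕ} (X Y : Fin N → Type*)
    [∀ t, MeasurableSpace (X t)] [∀ t, MetricSpace (X t)]
    [∀ t, PolishSpace (X t)] [∀ t, BorelSpace (X t)]
    [∀ t, MeasurableSpace (Y t)] [∀ t, MetricSpace (Y t)]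
    [∀ t, PolishSpace (Y t)] [∀ t, BorelSpace (Y t)]
    (p : ℝ) (hp : 1 ≤ p)
    (c : (∀ t, X t) × (∀ t, Y t) → ℝ) (hc : Continuous c) (hcg : GrowthLE p c)
    (μ : Measure (∀ t, X t)) (ν : Measure (∀ t, Y t))
    [IsProbabilityMeasure μ] [IsProbabilityMeasure ν]
    (hμp : MemPp p μ) (hνp : MemPp p ν)
    (μs : ℕ → Measure (∀ t, X t)) (νs : ℕ → Measure (∀ t, Y t))
    (hμs : ∀ n, IsProbabilityMeasure (μs n)) (hνs : ∀ n, IsProbabilityMeasure (νs n))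
    (hμsp : ∀ n, MemPp p (μs n)) (hνsp : ∀ n, MemPp p (νs n))
    (hμconv : Tendsto (fun n => W p .bicausal (μs n) μ) atTop (𝓝 0))
    (hνconv : Tendsto (fun n => W p .bicausal (νs n) ν) atTop (𝓝 0))
    (b : Flavor) :
    Tendsto (fun n => V b (μs n) (νs n) c) atTop (𝓝 (V b μ ν c)) ∧
    ∀ πs : ℕ → Measure ((∀ t, X t) × (∀ t, Y t)),
      (∀ n, πs n ∈ aCouplings b (μs n) (νs n)) →
      (∀ n, ∫ z, c z ∂(πs n) = V b (μs n) (νs n) c) →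
      ∀ π : Measure ((∀ t, X t) × (∀ t, Y t)), IsProbabilityMeasure π →
      ∀ φ : ℕ → ℕ, StrictMono φ → WeakTendsto (fun k => πs (φ k)) π →
      π ∈ aCouplings b μ ν ∧ ∫ z, c z ∂π = V b μ ν c := by
  refine ⟨tendsto_V hp hc hcg hμp hνp hμs hνs hμsp hνsp hμconv hνconv b, ?_⟩
  intro πs hπs hopt π hπ φ hφ h
  obtain ⟨hmem, ψ, hψ, hlim⟩ := exists_tendsto_integral_of_weakTendsto hp hc hcg hμp hνp
    (fun k => hμs (φ k)) (fun k => hνs (φ k)) (fun k => hμsp (φ k)) (fun k => hνsp (φ k))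
    (hμconv.comp hφ.tendsto_atTop) (hνconv.comp hφ.tendsto_atTop) (fun k => hπs (φ k)) h
  refine ⟨hmem, tendsto_nhds_unique hlim ?_⟩
  simp only [hopt]
  exact (tendsto_V hp hc hcg hμp hνp hμs hνs hμsp hνsp hμconv hνconv b).comp
    (hφ.tendsto_atTop.comp hψ.tendsto_atTop)

end AOT
end
end
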